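/- arXiv:2009.02953 — 2 statements merged into one kernel-verified Lean document; each statement's English description precedes it below -/
import Mathlib

section
/- For every odd integer g ≥ 5 there exists a constant C(g) such that every even hole-free graph G with tree-depth at most g contains at most C(g)·|V(G)| holes of length g. -/
open SimpleGraph

/-! ## Basic containment relations between graphs -/

/-- `H` is isomorphic to a (not necessarily induced) subgraph of `G`. -/
def IsSubgraphOf {V W : Type*} (H : SimpleGraph V) (G : SimpleGraph W) : Prop :=
  ∃ f : H →g G, Function.Injective f

/-- `H` is isomorphic to an induced subgraph of `G`. -/
def IsInducedSubgraphOf {V W : Type*} (H : SimpleGraph V) (G : SimpleGraph W) : Prop :=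
  Nonempty (H ↪g G)

/-- The clique number `ω(G)`: the largest `m` such that `K_m` is a subgraph of `G`. -/
noncomputable def omegaNum {V : Type*} (G : SimpleGraph V) : ℕ :=
  sSup {m | IsSubgraphOf (⊤ : SimpleGraph (Fin m)) G}

/-- The chromatic number `χ(G)` (as a natural number). -/
noncomputable def chi {V : Type*} (G : SimpleGraph V) : ℕ :=
  sInf {N | G.Colorable N}

/-! ## Tree-depth and the invariants `χ_p` -/

/-- A forest order: a partial order in which the down-set of every element is a chain.
Such orders are exactly the ancestor orders of rooted forests. -/
def IsForestOrder {V : Type*} (r : V → V → Prop) : Prop :=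
  (∀ v, r v v) ∧ (∀ u v, r u v → r v u → u = v) ∧
  (∀ u v w, r u v → r v w → r u w) ∧
  (∀ u v w, r u w → r v w → r u v ∨ r v u)

/-- `G` has tree-depth at most `h`: `G` is a subgraph of the closure of a rooted forest
of height at most `h` (height = maximum number of vertices on a root-to-leaf path). -/
def TreeDepthLE {V : Type*} (G : SimpleGraph V) (h : ℕ) : Prop :=
  ∃ r : V → V → Prop, IsForestOrder r ∧
    (∀ u v, G.Adj u v → r u v ∨ r v u) ∧
    (∀ v, {u | r u v}.ncard ≤ h)

/-- The tree-depth `td(G)`. -/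
noncomputable def treeDepth {V : Type*} (G : SimpleGraph V) : ℕ :=
  sInf {h | TreeDepthLE G h}

/-- `χ_p(G)`: the least number of colors of a vertex coloring such that every set `I` of at
most `p` colors induces a subgraph of tree-depth at most `|I|`. -/
noncomputable def chiP {V : Type*} (G : SimpleGraph V) (p : ℕ) : ℕ :=
  sInf {N | ∃ c : V → Fin N, ∀ I : Finset (Fin N), I.card ≤ p →
    TreeDepthLE (G.induce {v | c v ∈ I}) I.card}

/-! ## Star colorings -/

/-- A star coloring: a proper coloring with no path on `4` vertices using only two colors. -/
def IsStarColoring {V α : Type*} (G : SimpleGraph V) (c : V → α) : Prop :=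
  (∀ u v, G.Adj u v → c u ≠ c v) ∧
  ∀ x y z w : V, G.Adj x y → G.Adj y z → G.Adj z w →
    x ≠ z → y ≠ w → x ≠ w → ¬(c x = c z ∧ c y = c w)

/-- The star chromatic number `χ_s(G)`. -/
noncomputable def starChi {V : Type*} (G : SimpleGraph V) : ℕ :=
  sInf {N | ∃ c : V → Fin N, IsStarColoring G c}

/-! ## Subdivisions -/

/-- The edges of a graph on `Fin n`, presented as increasingly ordered pairs. -/
def Edges {n : ℕ} (H : SimpleGraph (Fin n)) : Type :=
  {p : Fin n × Fin n // p.1 < p.2 ∧ H.Adj p.1 p.2}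

/-- Base relation of the subdivision of `H`, where the edge `e` receives `t e` internal
vertices. -/
def subdivRel {n : ℕ} (H : SimpleGraph (Fin n)) (t : Edges H → ℕ) :
    (Fin n ⊕ Σ e : Edges H, Fin (t e)) → (Fin n ⊕ Σ e : Edges H, Fin (t e)) → Prop
  | Sum.inl u, Sum.inl v => ∃ h : u < v ∧ H.Adj u v, t ⟨(u, v), h⟩ = 0
  | Sum.inl u, Sum.inr ⟨e, i⟩ =>
      (u = e.1.1 ∧ (i : ℕ) = 0) ∨ (u = e.1.2 ∧ (i : ℕ) + 1 = t e)
  | Sum.inr ⟨e, i⟩, Sum.inr ⟨e', j⟩ => e = e' ∧ (i : ℕ) + 1 = (j : ℕ)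
  | _, _ => False

/-- The subdivision of `H` in which each edge `e` is replaced by a path with exactly `t e`
internal vertices. In particular `Subdiv H (fun _ => r)` is the `r`-subdivision `H^{(r)}`,
and the `(≤ r)`-subdivisions of `H` are the graphs `Subdiv H t` with `t e ≤ r` for all `e`. -/
def Subdiv {n : ℕ} (H : SimpleGraph (Fin n)) (t : Edges H → ℕ) :
    SimpleGraph (Fin n ⊕ Σ e : Edges H, Fin (t e)) :=
  SimpleGraph.fromRel (subdivRel H t)

/-- `H ∈ TM_r(G)`: some `(≤ r)`-subdivision of `H` is a subgraph of `G`. -/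
def MemTM {W : Type*} (r : ℕ) (G : SimpleGraph W) {n : ℕ} (H : SimpleGraph (Fin n)) : Prop :=
  ∃ t : Edges H → ℕ, (∀ e, t e ≤ r) ∧ IsSubgraphOf (Subdiv H t) G

/-- `H ∈ ITM_r^e(G)`: the exact `r`-subdivision of `H` is an induced subgraph of `G`. -/
def MemITM {W : Type*} (r : ℕ) (G : SimpleGraph W) {n : ℕ} (H : SimpleGraph (Fin n)) : Prop :=
  IsInducedSubgraphOf (Subdiv H (fun _ => r)) G

/-- `ω(TM_r(G))`: the supremum of the clique numbers of the graphs in `TM_r(G)`. -/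
noncomputable def omegaTM {W : Type*} (r : ℕ) (G : SimpleGraph W) : ℕ :=
  sSup {m | ∃ (k : ℕ) (H : SimpleGraph (Fin k)), MemTM r G H ∧ omegaNum H = m}

/-- The biclique number `bω(G)`: the largest `s` with `K_{s,s}` a subgraph of `G`. -/
noncomputable def bomega {V : Type*} (G : SimpleGraph V) : ℕ :=
  sSup {s | IsSubgraphOf (completeBipartiteGraph (Fin s) (Fin s)) G}

/-- The average degree `d̄(G) = 2|E(G)|/|V(G)|`. -/
noncomputable def avgDeg {n : ℕ} (G : SimpleGraph (Fin n)) : ℝ :=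
  2 * (G.edgeSet.ncard : ℝ) / n

/-! ## Classes of graphs -/

/-- A class of (finite, simple) graphs: for each `n`, a set of graphs on `Fin n`.
Classes are implicitly closed under isomorphism via the relations used below. -/
def GraphClass := ∀ n : ℕ, Set (SimpleGraph (Fin n))

/-- A hereditary class: closed under induced subgraphs (hence under isomorphism). -/
def Hereditary (C : GraphClass) : Prop :=
  ∀ ⦃n m : ℕ⦄ (G : SimpleGraph (Fin n)) (H : SimpleGraph (Fin m)),
    G ∈ C n → IsInducedSubgraphOf H G → H ∈ C m

/-- A monotone class: closed under subgraphs (hence under isomorphism). -/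
def MonotoneClass (C : GraphClass) : Prop :=
  ∀ ⦃n m : ℕ⦄ (G : SimpleGraph (Fin n)) (H : SimpleGraph (Fin m)),
    G ∈ C n → IsSubgraphOf H G → H ∈ C m

/-- `H ∈ TM_r(𝒞)`. -/
def MemTMClass (r : ℕ) (C : GraphClass) {m : ℕ} (H : SimpleGraph (Fin m)) : Prop :=
  ∃ (n : ℕ) (G : SimpleGraph (Fin n)), G ∈ C n ∧ MemTM r G H

/-- `H ∈ ITM_r^e(𝒞)`. -/
def MemITMClass (r : ℕ) (C : GraphClass) {m : ℕ} (H : SimpleGraph (Fin m)) : Prop :=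
  ∃ (n : ℕ) (G : SimpleGraph (Fin n)), G ∈ C n ∧ MemITM r G H

/-- `𝒞` is `χ`-bounded: `χ(H) ≤ f(ω(H))` for every induced subgraph `H` of a graph of `𝒞`. -/
def ChiBounded (C : GraphClass) : Prop :=
  ∃ f : ℕ → ℕ, ∀ ⦃n : ℕ⦄ (G : SimpleGraph (Fin n)), G ∈ C n →
    ∀ ⦃m : ℕ⦄ (H : SimpleGraph (Fin m)), IsInducedSubgraphOf H G →
      chi H ≤ f (omegaNum H)

/-- `𝒞` has bounded expansion: for every `r`, `d̄(TM_r(𝒞)) < ∞`. -/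
def BoundedExpansion (C : GraphClass) : Prop :=
  ∀ r : ℕ, ∃ d : ℝ, ∀ ⦃m : ℕ⦄ (H : SimpleGraph (Fin m)), MemTMClass r C H → avgDeg H ≤ d

/-- `𝒞` has `ω`-bounded expansion. -/
def OmegaBoundedExpansion (C : GraphClass) : Prop :=
  ∃ f : ℕ → ℕ → ℝ, ∀ ⦃n : ℕ⦄ (G : SimpleGraph (Fin n)), G ∈ C n →
    ∀ (r : ℕ) ⦃m : ℕ⦄ (H : SimpleGraph (Fin m)), MemTM r G H →
      avgDeg H ≤ f (omegaNum G) r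

/-- `𝒞` is nowhere dense: for every `r`, `ω(TM_r(𝒞)) < ∞`. -/
def NowhereDense (C : GraphClass) : Prop :=
  ∀ r : ℕ, ∃ c : ℕ, ∀ ⦃m : ℕ⦄ (H : SimpleGraph (Fin m)), MemTMClass r C H → omegaNum H ≤ c

/-- `𝒞` is strongly `χ_p`-bounded: `χ_p(G) ≤ f_p(ω(G))` on `𝒞`. -/
def StronglyChiPBounded (C : GraphClass) (p : ℕ) : Prop :=
  ∃ f : ℕ → ℕ, ∀ ⦃n : ℕ⦄ (G : SimpleGraph (Fin n)), G ∈ C n → chiP G p ≤ f (omegaNum G)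

/-- `𝒞` is weakly `χ_p`-bounded: `χ_p(G) ≤ g_p(ω(TM_{p-1}(G)))` on `𝒞`. -/
def WeaklyChiPBounded (C : GraphClass) (p : ℕ) : Prop :=
  ∃ g : ℕ → ℕ, ∀ ⦃n : ℕ⦄ (G : SimpleGraph (Fin n)), G ∈ C n → chiP G p ≤ g (omegaTM (p - 1) G)

/-! ## Directed graphs, orientations and restricted dualities -/

/-- Existence of a homomorphism between directed graphs presented as binary relations. -/
def DigraphHomEx {n m : ℕ} (A : Fin n → Fin n → Prop) (B : Fin m → Fin m → Prop) : Prop :=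
  ∃ f : Fin n → Fin m, ∀ u v, A u v → B (f u) (f v)

/-- `A` is an orientation of the graph `G`. -/
def IsOrientationOf {n : ℕ} (A : Fin n → Fin n → Prop) (G : SimpleGraph (Fin n)) : Prop :=
  (∀ u v, ¬(A u v ∧ A v u)) ∧ (∀ u v, G.Adj u v ↔ (A u v ∨ A v u))

/-- A directed graph is acyclic if it has no directed cycle. -/
def IsAcyclicDigraph {n : ℕ} (A : Fin n → Fin n → Prop) : Prop :=
  ∀ v, ¬ Relation.TransGen A v v

/-- The directed graph `F` has a restricted dual for the class of all orientations of the
graphs of `𝒞`. -/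
def HasRestrictedDualForOrientations (C : GraphClass) {nF : ℕ}
    (F : Fin nF → Fin nF → Prop) : Prop :=
  ∃ (m : ℕ) (D : Fin m → Fin m → Prop),
    ¬ DigraphHomEx F D ∧
    ∀ ⦃n : ℕ⦄ (A : Fin n → Fin n → Prop) (G : SimpleGraph (Fin n)),
      G ∈ C n → IsOrientationOf A G →
      (¬ DigraphHomEx F A ↔ DigraphHomEx A D)

/-! ## Holes -/

/-- The number `h_g(G)` of holes of length `g` in `G`, i.e. of vertex subsets inducing a
cycle on `g` vertices. -/
noncomputable def holeCount {n : ℕ} (g : ℕ) (G : SimpleGraph (Fin n)) : ℕ :=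
  {S : Set (Fin n) | Nonempty (G.induce S ≃g SimpleGraph.cycleGraph g)}.ncard

/-- `G` is even hole-free: it has no induced cycle of even length at least `4`. -/
def EvenHoleFree {n : ℕ} (G : SimpleGraph (Fin n)) : Prop :=
  ∀ g : ℕ, 4 ≤ g → Even g → holeCount g G = 0

section Holes

variable {n : ℕ} {G : SimpleGraph (Fin n)}

theorem cycleGraph_adj_iff_val {N : ℕ} (hN : 2 ≤ N) {u v : Fin N} :
    (cycleGraph N).Adj u v ↔ (u : ℕ) + 1 = v ∨ (v : ℕ) + 1 = u ∨
      ((u : ℕ) = 0 ∧ (v : ℕ) + 1 = N) ∨ ((v : ℕ) = 0 ∧ (u : ℕ) + 1 = N) := by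
  rw [cycleGraph_adj']
  have hu := u.isLt
  have hv := v.isLt
  rcases lt_trichotomy u v with h | h | h
  · rw [Fin.coe_sub_iff_lt.2 h, Fin.coe_sub_iff_le.2 h.le]
    rw [Fin.lt_def] at h
    omega
  · subst h
    rw [Fin.coe_sub_iff_le.2 le_rfl]
    omega
  · rw [Fin.coe_sub_iff_lt.2 h, Fin.coe_sub_iff_le.2 h.le]
    rw [Fin.lt_def] at h
    omega

theorem EvenHoleFree.isEmpty_cycleGraph_embedding (hG : EvenHoleFree G) {N : ℕ} (hN : 4 ≤ N)
    (heven : Even N) : IsEmpty (cycleGraph N ↪g G) := by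
  refine ⟨fun f => ?_⟩
  have h := (Set.ncard_eq_zero (Set.toFinite _)).1 (hG N hN heven)
  exact Set.notMem_empty (Set.range f) (h ▸ ⟨f.isoInduceRange.symm⟩)

/-- The induced paths of length `m` from `a` to `b`. -/
def inducedPaths (G : SimpleGraph (Fin n)) (a b : Fin n) (m : ℕ) : Set (pathGraph (m + 1) ↪g G) :=
  {p | p 0 = a ∧ p (Fin.last m) = b}

/-- The set of inner vertices of an induced path. -/
def pathInterior {m : ℕ} (p : pathGraph (m + 1) ↪g G) : Finset (Fin n) :=
  (Finset.Ioo 0 (Fin.last m)).map p.toEmbedding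

theorem card_pathInterior_le {m : ℕ} (p : pathGraph (m + 1) ↪g G) :
    (pathInterior p).card ≤ m := by
  simp [pathInterior]

/-- Two induced paths of equal length with common ends cannot have disjoint interiors with no
edge in between. -/
theorem EvenHoleFree.exists_eq_or_adj (hG : EvenHoleFree G) {a b : Fin n} {m : ℕ} (hm : 2 ≤ m)
    {p q : pathGraph (m + 1) ↪g G} (hp : p ∈ inducedPaths G a b m)
    (hq : q ∈ inducedPaths G a b m) :
    ∃ x ∈ pathInterior p, ∃ y ∈ pathInterior q, x = y ∨ G.Adj x y := by
  by_contra! hcon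
  obtain ⟨P, hP⟩ : ∃ P : ℕ → Fin n, ∀ k : Fin (m + 1), P k = p k :=
    ⟨fun k => p (Fin.ofNat _ k), fun k => by simp⟩
  obtain ⟨Q, hQ⟩ : ∃ Q : ℕ → Fin n, ∀ k : Fin (m + 1), Q k = q k :=
    ⟨fun k => q (Fin.ofNat _ k), fun k => by simp⟩
  have hPQ0 : Q 0 = P 0 := by
    have h1 := hP 0
    have h2 := hQ 0
    simp only [Fin.val_zero] at h1 h2
    rw [h1, h2, hp.1, hq.1]
  have hPQm : Q m = P m := by
    have h1 := hP (Fin.last m)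
    have h2 := hQ (Fin.last m)
    simp only [Fin.val_last] at h1 h2
    rw [h1, h2, hp.2, hq.2]
  have hPi : ∀ i j, i ≤ m → j ≤ m → (P i = P j ↔ i = j) := fun i j hi hj => by
    have h1 := hP ⟨i, by omega⟩
    have h2 := hP ⟨j, by omega⟩
    simp only at h1 h2
    rw [h1, h2, p.injective.eq_iff, Fin.mk.injEq]
  have hQi : ∀ i j, i ≤ m → j ≤ m → (Q i = Q j ↔ i = j) := fun i j hi hj => by
    have h1 := hQ ⟨i, by omega⟩
    have h2 := hQ ⟨j, by omega⟩
    simp only at h1 h2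
    rw [h1, h2, q.injective.eq_iff, Fin.mk.injEq]
  have hPa : ∀ i j, i ≤ m → j ≤ m → (G.Adj (P i) (P j) ↔ i + 1 = j ∨ j + 1 = i) :=
    fun i j hi hj => by
      have h1 := hP ⟨i, by omega⟩
      have h2 := hP ⟨j, by omega⟩
      simp only at h1 h2
      rw [h1, h2, p.map_adj_iff, pathGraph_adj]
  have hQa : ∀ i j, i ≤ m → j ≤ m → (G.Adj (Q i) (Q j) ↔ i + 1 = j ∨ j + 1 = i) :=
    fun i j hi hj => by
      have h1 := hQ ⟨i, by omega⟩
      have h2 := hQ ⟨j, by omega⟩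
      simp only at h1 h2
      rw [h1, h2, q.map_adj_iff, pathGraph_adj]
  have hfar : ∀ i j, 0 < i → i < m → 0 < j → j < m → P i ≠ Q j ∧ ¬ G.Adj (P i) (Q j) :=
    fun i j hi hi' hj hj' => by
      have h1 := hP ⟨i, by omega⟩
      have h2 := hQ ⟨j, by omega⟩
      simp only at h1 h2
      rw [h1, h2]
      refine hcon _ (Finset.mem_map_of_mem _ ?_) _ (Finset.mem_map_of_mem _ ?_) <;>
        simp [Fin.lt_def, *]
  have hPQi : ∀ i j, i ≤ m → 0 < j → j < m → P i ≠ Q j := fun i j hi hj hj' => by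
    rcases Nat.eq_zero_or_pos i with rfl | hi0
    · rw [← hPQ0, Ne, hQi _ _ hi hj'.le]
      omega
    rcases hi.eq_or_lt with rfl | him
    · rw [← hPQm, Ne, hQi _ _ hi hj'.le]
      omega
    · exact (hfar i j hi0 him hj hj').1
  have hPQa : ∀ i j, i ≤ m → 0 < j → j < m →
      (G.Adj (P i) (Q j) ↔ (i = 0 ∧ j = 1) ∨ (i = m ∧ j + 1 = m)) := fun i j hi hj hj' => by
    rcases Nat.eq_zero_or_pos i with rfl | hi0
    · rw [← hPQ0, hQa _ _ hi hj'.le]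
      omega
    rcases hi.eq_or_lt with rfl | him
    · rw [← hPQm, hQa _ _ hi hj'.le]
      omega
    · simp only [(hfar i j hi0 him hj hj').2, false_iff]
      omega
  let f : Fin (m + m) → Fin n := fun k => if (k : ℕ) ≤ m then P k else Q (m + m - k)
  have hinj : Function.Injective f := fun u v huv => by
    have hu := u.isLt
    have hv := v.isLt
    ext
    simp only [f] at huv
    split_ifs at huv with h1 h2 h2
    · exact (hPi _ _ h1 h2).1 huv
    · exact absurd huv (hPQi _ _ h1 (by omega) (by omega))
    · exact absurd huv.symm (hPQi _ _ h2 (by omega) (by omega))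
    · have := (hQi _ _ (by omega) (by omega)).1 huv
      omega
  refine (hG.isEmpty_cycleGraph_embedding (N := m + m) (by omega) ⟨m, rfl⟩).false
    ⟨⟨f, hinj⟩, fun {u v} => ?_⟩
  have hu := u.isLt
  have hv := v.isLt
  rw [cycleGraph_adj_iff_val (by omega)]
  simp only [f, Function.Embedding.coeFn_mk]
  split_ifs with h1 h2 h2
  · rw [hPa _ _ h1 h2]
    omega
  · rw [hPQa _ _ h1 (by omega) (by omega)]
    omega
  · rw [G.adj_comm, hPQa _ _ h2 (by omega) (by omega)]
    omega
  · rw [hQa _ _ (by omega) (by omega)]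
    omega

theorem card_le_two_mul_of_total {α : Type*} (F : Finset α) (D : α → α → Prop) (k : ℕ)
    (htot : ∀ a ∈ F, ∀ b ∈ F, D a b ∨ D b a)
    (hk : ∀ a ∈ F, {b | b ∈ F ∧ D a b}.ncard ≤ k) : F.card ≤ 2 * k := by
  classical
  have hk' : ∀ a ∈ F, (F.filter (D a)).card ≤ k := fun a ha => by
    rw [← Set.ncard_coe_finset]
    simpa using hk a ha
  have hsum : F.card * F.card ≤ F.card * (2 * k) := calc
    F.card * F.card = ∑ _a ∈ F, F.card := by simp
    _ ≤ ∑ a ∈ F, ((F.filter (D a)).card + (F.filter fun b => D b a).card) :=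
        Finset.sum_le_sum fun a ha => by
          refine le_trans (Finset.card_le_card fun b hb => ?_) (Finset.card_union_le _ _)
          simpa [hb] using htot a ha b hb
    _ = ∑ a ∈ F, (F.filter (D a)).card + ∑ a ∈ F, (F.filter (D a)).card := by
        rw [Finset.sum_add_distrib]
        congr 1
        exact (Finset.sum_card_bipartiteAbove_eq_sum_card_bipartiteBelow D).symm
    _ ≤ F.card * k + F.card * k :=
        add_le_add (Finset.sum_le_card_nsmul _ _ _ hk') (Finset.sum_le_card_nsmul _ _ _ hk')
    _ = F.card * (2 * k) := by ring
  rcases F.card.eq_zero_or_pos with h | h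
  · omega
  · exact le_of_mul_le_mul_left hsum h

/-- If every vertex has few `r`-predecessors and any two members of a family of small sets contain
`r`-comparable elements, then the family has a small transversal. -/
theorem exists_small_transversal {r : Fin n → Fin n → Prop} {s t : ℕ}
    (hr : ∀ v, {u | r u v}.ncard ≤ t) (A : Set (Finset (Fin n))) (hs : ∀ S ∈ A, S.card ≤ s)
    (hA : ∀ S ∈ A, ∀ T ∈ A, ∃ x ∈ S, ∃ y ∈ T, r x y ∨ r y x) :
    ∃ X : Finset (Fin n), X.card ≤ 2 * (s * t) * s ∧ ∀ S ∈ A, ∃ x ∈ S, x ∈ X := by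
  classical
  obtain ⟨F, hF⟩ := (Set.toFinite
    {F : Finset (Finset (Fin n)) | ↑F ⊆ A ∧ (F : Set (Finset (Fin n))).PairwiseDisjoint id}
    ).exists_maximal ⟨∅, by simp⟩
  obtain ⟨⟨hFA, hdisj⟩, hmax⟩ := hF
  have hcard : F.card ≤ 2 * (s * t) := by
    refine card_le_two_mul_of_total F (fun S T => ∃ x ∈ S, ∃ y ∈ T, r y x) _
      (fun S hS T hT => ?_) (fun S hS => ?_)
    · obtain ⟨x, hx, y, hy, h | h⟩ := hA S (hFA hS) T (hFA hT)
      · exact Or.inr ⟨y, hy, x, hx, h⟩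
      · exact Or.inl ⟨x, hx, y, hy, h⟩
    · let U := S.biUnion fun x => Finset.univ.filter fun u => r u x
      have hU : U.card ≤ s * t := by
        refine (Finset.card_biUnion_le_card_mul _ _ t fun x _ => ?_).trans
          (Nat.mul_le_mul_right _ (hs S (hFA hS)))
        rw [← Set.ncard_coe_finset]
        simpa using hr x
      let F' := F.filter fun T => ∃ x ∈ S, ∃ y ∈ T, r y x
      have hF' : {T | T ∈ F ∧ ∃ x ∈ S, ∃ y ∈ T, r y x} = (F' : Set (Finset (Fin n))) := by
        ext; simp [F']
      rw [hF', Set.ncard_coe_finset]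
      calc F'.card ≤ (F'.biUnion fun T => T ∩ U).card := by
            refine Finset.card_le_card_biUnion (fun T hT T' hT' hne => ?_) fun T hT => ?_
            · exact (hdisj (Finset.filter_subset _ _ hT) (Finset.filter_subset _ _ hT') hne).mono
                Finset.inter_subset_left Finset.inter_subset_left
            · obtain ⟨x, hx, y, hy, h⟩ := (Finset.mem_filter.1 hT).2
              exact ⟨y, by simpa [U, hy] using ⟨x, hx, h⟩⟩
        _ ≤ U.card := Finset.card_le_card <| Finset.biUnion_subset.2 fun T _ =>
            Finset.inter_subset_right
        _ ≤ s * t := hU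
  refine ⟨F.biUnion id, ?_, fun S hS => ?_⟩
  · exact (Finset.card_biUnion_le_card_mul _ _ s fun S hS => hs S (hFA hS)).trans
      (Nat.mul_le_mul_right _ hcard)
  · by_contra! hcon
    have hSF : S ∈ F := by
      refine hmax (y := insert S F) ⟨?_, ?_⟩ (Finset.subset_insert _ _) (Finset.mem_insert_self _ _)
      · rw [Finset.coe_insert]
        exact Set.insert_subset hS hFA
      · rw [Finset.coe_insert]
        refine hdisj.insert fun T hT _ => Finset.disjoint_left.2 fun x hx hxT => ?_
        exact hcon x hx (Finset.mem_biUnion.2 ⟨T, hT, hxT⟩)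
    obtain ⟨x, hx, -⟩ := hA S hS S hS
    exact hcon x hx (Finset.mem_biUnion.2 ⟨S, hSF, hx⟩)

/-- The embedding of a path into a longer one that skips the first `c` vertices. -/
def pathGraphShift {k m : ℕ} (c : ℕ) (h : c + k ≤ m) : pathGraph k ↪g pathGraph m where
  toEmbedding := ⟨fun j => ⟨c + j, by omega⟩, fun i j hij => by
    simp only [Fin.mk.injEq] at hij
    omega⟩
  map_rel_iff' {i j} := by
    rw [pathGraph_adj, pathGraph_adj]
    change c + (i : ℕ) + 1 = c + j ∨ c + (j : ℕ) + 1 = c + i ↔ _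
    omega

@[simp]
theorem val_pathGraphShift {k m : ℕ} (c : ℕ) (h : c + k ≤ m) (j : Fin k) :
    (pathGraphShift c h j : ℕ) = c + j := rfl

theorem ncard_inducedPaths_through_le {m : ℕ} (a b x : Fin n) (i : Fin (m + 1)) :
    {p ∈ inducedPaths G a b m | p i = x}.ncard ≤
      (inducedPaths G a x i).ncard * (inducedPaths G x b (m - i)).ncard := by
  have hi := i.isLt
  rw [← Set.ncard_prod]
  refine Set.ncard_le_ncard_of_injOn
    (fun p => ((pathGraphShift 0 (by omega)).trans p, (pathGraphShift i (by omega)).trans p))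
    ?_ ?_ (Set.toFinite _)
  · rintro p ⟨⟨rfl, rfl⟩, rfl⟩
    refine ⟨⟨?_, ?_⟩, ?_, ?_⟩ <;> refine congrArg p (Fin.ext ?_) <;> simp
    omega
  · intro p _ q _ hpq
    obtain ⟨h1, h2⟩ := Prod.mk.inj hpq
    ext1 k
    have hk := k.isLt
    by_cases hki : (k : ℕ) ≤ i
    · have hk' : pathGraphShift 0 (by omega) (⟨k, by omega⟩ : Fin (i + 1)) = k :=
        Fin.ext (by simp)
      rw [← hk']
      exact DFunLike.congr_fun h1 _
    · have hk' : pathGraphShift i (by omega) (⟨k - i, by omega⟩ : Fin (m - i + 1)) = k :=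
        Fin.ext (by simp only [val_pathGraphShift]; omega)
      rw [← hk']
      exact DFunLike.congr_fun h2 _

/-- An upper bound on the number of induced paths of length at most `m` between two vertices of an
even hole-free graph having an orientation with in-degrees at most `t`. -/
def pathBound (t : ℕ) : ℕ → ℕ
  | 0 => 1
  | m + 1 => 1 + 2 * ((m + 1) * t) * (m + 1) * ((m + 2) * (pathBound t m * pathBound t m))

theorem pathBound_pos (t m : ℕ) : 0 < pathBound t m := by
  cases m <;> simp [pathBound]

theorem ncard_inducedPaths_le_one {a b : Fin n} {m : ℕ} (hm : m ≤ 1) :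
    (inducedPaths G a b m).ncard ≤ 1 := by
  refine (Set.ncard_le_one (Set.toFinite _)).2 fun p hp q hq => ?_
  ext1 k
  have hk := k.isLt
  rcases Nat.eq_zero_or_pos (k : ℕ) with h | h
  · rw [show k = 0 from Fin.ext h, hp.1, hq.1]
  · rw [show k = Fin.last m from Fin.ext (by rw [Fin.val_last]; omega), hp.2, hq.2]

theorem EvenHoleFree.ncard_inducedPaths_le_of_le (hG : EvenHoleFree G) {r : Fin n → Fin n → Prop}
    {t : ℕ} (hrefl : ∀ v, r v v) (hadj : ∀ u v, G.Adj u v → r u v ∨ r v u)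
    (hr : ∀ v, {u | r u v}.ncard ≤ t) (m : ℕ) :
    ∀ k ≤ m, ∀ a b, (inducedPaths G a b k).ncard ≤ pathBound t m := by
  induction m with
  | zero =>
    intro k hk a b
    exact (ncard_inducedPaths_le_one (by omega)).trans (pathBound_pos t 0)
  | succ m ih =>
    intro k hk a b
    rcases le_or_gt k 1 with hk1 | hk1
    · exact (ncard_inducedPaths_le_one hk1).trans (pathBound_pos t _)
    obtain ⟨X, hXcard, hX⟩ := exists_small_transversal hr (s := m + 1)
      (pathInterior '' inducedPaths G a b k)
      (by
        rintro _ ⟨p, -, rfl⟩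
        exact (card_pathInterior_le p).trans hk)
      (by
        rintro _ ⟨p, hp, rfl⟩ _ ⟨q, hq, rfl⟩
        obtain ⟨x, hx, y, hy, rfl | h⟩ := hG.exists_eq_or_adj hk1 hp hq
        · exact ⟨x, hx, x, hy, Or.inl (hrefl x)⟩
        · exact ⟨x, hx, y, hy, hadj x y h⟩)
    let I : Finset (Fin (k + 1)) := Finset.Ioo 0 (Fin.last k)
    have hI : I.card ≤ m + 2 := by
      simp only [I, Fin.card_Ioo, Fin.val_last, Fin.val_zero]
      omega
    have hcover : inducedPaths G a b k ⊆
        ⋃ z ∈ X ×ˢ I, {p ∈ inducedPaths G a b k | p z.2 = z.1} := fun p hp => by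
      obtain ⟨x, hx, hxX⟩ := hX _ ⟨p, hp, rfl⟩
      obtain ⟨i, hi, rfl⟩ := Finset.mem_map.1 hx
      exact Set.mem_biUnion (x := (p i, i)) (Finset.mem_product.2 ⟨hxX, hi⟩) ⟨hp, rfl⟩
    calc (inducedPaths G a b k).ncard
        ≤ _ := Set.ncard_le_ncard hcover (Set.toFinite _)
      _ ≤ _ := Finset.set_ncard_biUnion_le _ _
      _ ≤ (X ×ˢ I).card * (pathBound t m * pathBound t m) := by
          refine Finset.sum_le_card_nsmul _ _ _ fun z hz => ?_
          have hzI := Finset.mem_Ioo.1 (Finset.mem_product.1 hz).2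
          simp only [Fin.lt_def, Fin.val_zero, Fin.val_last] at hzI
          exact (ncard_inducedPaths_through_le a b z.1 z.2).trans
            (Nat.mul_le_mul (ih _ (by omega) _ _) (ih _ (by omega) _ _))
      _ ≤ (2 * ((m + 1) * t) * (m + 1) * (m + 2)) * (pathBound t m * pathBound t m) := by
          rw [Finset.card_product]
          gcongr
      _ ≤ pathBound t (m + 1) := by
          rw [pathBound, ← mul_assoc _ (m + 2)]
          exact Nat.le_add_left _ _

/-- The embedding of a path into a cycle that misses just the vertex `i`. -/
theorem exists_pathGraph_embedding_cycleGraph {m : ℕ} (hm : 1 ≤ m) (i : Fin (m + 2)) :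
    ∃ e : pathGraph (m + 1) ↪g cycleGraph (m + 2), Set.range e = {i}ᶜ ∧
      (cycleGraph (m + 2)).Adj (e 0) i ∧ (cycleGraph (m + 2)).Adj (e (Fin.last m)) i := by
  have hinj : Function.Injective fun k : Fin (m + 1) => i + k.succ :=
    (add_right_injective i).comp (Fin.succ_injective _)
  refine ⟨⟨⟨_, hinj⟩, fun {u v} => ?_⟩, ?_, ?_, ?_⟩
  · simp only [Function.Embedding.coeFn_mk, cycleGraph_adj, add_sub_add_left_eq_sub, pathGraph_adj]
    rw [← cycleGraph_adj, cycleGraph_adj_iff_val (by omega)]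
    simp only [Fin.val_succ]
    omega
  · ext x
    simp only [RelEmbedding.coe_mk, Function.Embedding.coeFn_mk, Set.mem_range, Set.mem_compl_iff,
      Set.mem_singleton_iff]
    constructor
    · rintro ⟨k, rfl⟩ h
      exact absurd (add_eq_left.1 h) (Fin.succ_ne_zero k)
    · intro h
      obtain ⟨k, hk⟩ := Fin.exists_succ_eq.2 (sub_ne_zero.2 h)
      exact ⟨k, by rw [hk]; abel⟩
  · simp [cycleGraph_adj]
  · simp [cycleGraph_adj, Fin.succ_last]

/-- A hole consists of an `r`-maximal vertex `v` and an induced path joining two of its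
predecessors. -/
theorem exists_inducedPaths_of_hole {r : Fin n → Fin n → Prop} (hforest : IsForestOrder r)
    (hadj : ∀ u v, G.Adj u v → r u v ∨ r v u) {m : ℕ} (hm : 1 ≤ m)
    (f : cycleGraph (m + 2) ↪g G) :
    ∃ v a b, r a v ∧ r b v ∧ ∃ p ∈ inducedPaths G a b m, Set.range f = insert v (Set.range p) := by
  obtain ⟨-, hanti, htrans, -⟩ := hforest
  let below : Fin (m + 2) → Fin (m + 2) → Prop := fun i j => r (f j) (f i) ∧ f j ≠ f i
  have : IsTrans _ below := ⟨fun i j k hij hjk => ⟨htrans _ _ _ hjk.1 hij.1, fun h =>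
    hij.2 (hanti _ _ hij.1 (h ▸ hjk.1))⟩⟩
  have : Std.Irrefl below := ⟨fun i hi => hi.2 rfl⟩
  obtain ⟨i, -, hi⟩ := (Finite.wellFounded_of_trans_of_irrefl below).has_min Set.univ ⟨0, trivial⟩
  obtain ⟨e, he, he0, hem⟩ := exists_pathGraph_embedding_cycleGraph hm i
  have key : ∀ j, (cycleGraph (m + 2)).Adj j i → r (f j) (f i) := fun j hj => by
    rcases hadj _ _ (f.map_adj_iff.2 hj) with h | h
    · exact h
    · exact absurd ⟨h, fun h' => hj.ne (f.injective h').symm⟩ (hi j trivial)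
  refine ⟨f i, f (e 0), f (e (Fin.last m)), key _ he0, key _ hem, e.trans f, ⟨rfl, rfl⟩, ?_⟩
  rw [RelEmbedding.coe_trans, Set.range_comp, he, ← Set.image_insert_eq, Set.insert_eq,
    Set.union_compl_self, Set.image_univ]

end Holes

/-- For every odd `g ≥ 5` there is a constant `C(g)` such that every even
hole-free graph of tree-depth at most `g` has at most `C(g)·|V(G)|` holes of length `g`. -/
theorem holes_linear_of_treeDepth (g : ℕ) (hodd : Odd g) (hg : 5 ≤ g) :
    ∃ c : ℕ, ∀ (n : ℕ) (G : SimpleGraph (Fin n)),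
      EvenHoleFree G → TreeDepthLE G g → holeCount g G ≤ c * n := by
  classical
  obtain ⟨m, rfl⟩ : ∃ m, g = m + 2 := ⟨g - 2, by omega⟩
  set t := m + 2 with ht
  refine ⟨t * t * pathBound t m, fun n G hG ⟨r, hforest, hadj, hr⟩ => ?_⟩
  let P : Fin n → Finset (Fin n) := fun v => Finset.univ.filter fun u => r u v
  have hP : ∀ v, (P v).card ≤ t := fun v => by
    rw [← Set.ncard_coe_finset]
    simpa [P] using hr v
  let I := Finset.univ.sigma fun v => P v ×ˢ P v
  have hI : I.card ≤ n * (t * t) := by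
    rw [Finset.card_sigma]
    refine (Finset.sum_le_card_nsmul _ _ (t * t) fun v _ => ?_).trans (by simp)
    rw [Finset.card_product]
    exact Nat.mul_le_mul (hP v) (hP v)
  have hcover : {S : Set (Fin n) | Nonempty (G.induce S ≃g cycleGraph t)} ⊆
      ⋃ z ∈ I, (fun p : pathGraph (m + 1) ↪g G => insert z.1 (Set.range p)) ''
        inducedPaths G z.2.1 z.2.2 m := by
    rintro S ⟨φ⟩
    obtain ⟨v, a, b, ha, hb, p, hp, hS⟩ := exists_inducedPaths_of_hole hforest hadj (by omega)
      (φ.symm.toEmbedding.trans (Embedding.induce S))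
    refine Set.mem_biUnion (x := ⟨v, a, b⟩) (by simp [I, P, ha, hb]) ⟨p, hp, hS.symm.trans ?_⟩
    rw [RelEmbedding.coe_trans, Set.range_comp]
    change _ '' Set.range φ.symm = S
    rw [φ.symm.surjective.range_eq, Set.image_univ]
    exact Subtype.range_val
  calc holeCount t G ≤ _ := Set.ncard_le_ncard hcover (Set.toFinite _)
    _ ≤ _ := Finset.set_ncard_biUnion_le _ _
    _ ≤ I.card * pathBound t m := Finset.sum_le_card_nsmul _ _ _ fun z _ =>
        (Set.ncard_image_le (Set.toFinite _)).trans
          (hG.ncard_inducedPaths_le_of_le hforest.1 hadj hr m m le_rfl _ _)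
    _ ≤ n * (t * t) * pathBound t m := Nat.mul_le_mul_right _ hI
    _ = t * t * pathBound t m * n := by ring
end

section
/- There exists a function φ : ℕ×ℕ → ℕ such that for every odd integer g > 3 and every even hole-free graph G, the number of holes of length g in G satisfies h_g(G) ≤ φ(g, ω(G))·|V(G)|. -/
open SimpleGraph

theorem EvenHoleFree.not_hole_seq {n : ℕ} {G : SimpleGraph (Fin n)} (hG : EvenHoleFree G)
    {L : ℕ} (hL : 4 ≤ L) (hLe : Even L) (c : ℕ → Fin n)
    (hne : ∀ i j, i < j → j < L → c i ≠ c j)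
    (hadj : ∀ i j, i < j → j < L → (G.Adj (c i) (c j) ↔ j = i + 1 ∨ (i = 0 ∧ j + 1 = L))) :
    False := by
  have h0 := hG L hL hLe
  obtain ⟨m, rfl⟩ : ∃ m, L = m + 1 := ⟨L - 1, by omega⟩
  unfold holeCount at h0
  rw [Set.ncard_eq_zero (Set.toFinite _)] at h0
  have hinj : Function.Injective (fun i : Fin (m + 1) => c i) := by
    intro i j hij
    rcases lt_trichotomy (i : ℕ) j with h | h | h
    · exact absurd hij (hne _ _ h j.2)
    · exact Fin.ext h
    · exact absurd hij.symm (hne _ _ h i.2)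
  have hval : ∀ i j : Fin (m + 1), i < j →
      (G.Adj (c i) (c j) ↔ (cycleGraph (m + 1)).Adj i j) := by
    intro i j hij
    rw [hadj i j hij j.2, cycleGraph_adj']
    rw [Fin.coe_sub_iff_lt.2 hij, Fin.coe_sub_iff_le.2 hij.le]
    have := i.2
    have := j.2
    have : (i : ℕ) < j := hij
    omega
  have hval' : ∀ i j : Fin (m + 1),
      (G.Adj (c i) (c j) ↔ (cycleGraph (m + 1)).Adj i j) := by
    intro i j
    rcases lt_trichotomy i j with h | h | h
    · exact hval i j h
    · subst h; simp
    · rw [G.adj_comm, hval j i h, adj_comm]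
  have hmem : Set.range (fun i : Fin (m + 1) => c i) ∈
      {S : Set (Fin n) | Nonempty (G.induce S ≃g SimpleGraph.cycleGraph (m + 1))} := by
    refine ⟨RelIso.symm ⟨Equiv.ofInjective _ hinj, ?_⟩⟩
    intro i j
    simpa using hval' i j
  rw [h0] at hmem
  exact hmem

theorem card_le_omegaNum {n : ℕ} (G : SimpleGraph (Fin n)) (K : Finset (Fin n))
    (hK : ∀ x ∈ K, ∀ y ∈ K, x ≠ y → G.Adj x y) : K.card ≤ omegaNum G := by
  refine le_csSup ⟨n, ?_⟩ ?_
  · rintro m ⟨f, hf⟩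
    simpa using Fintype.card_le_of_injective f hf
  · refine ⟨⟨fun i => K.orderEmbOfFin rfl i, ?_⟩, (K.orderEmbOfFin rfl).injective⟩
    intro a b hab
    refine hK _ (Finset.orderEmbOfFin_mem _ _ _) _ (Finset.orderEmbOfFin_mem _ _ _) ?_
    exact fun h => hab ((K.orderEmbOfFin rfl).injective h)

theorem EvenHoleFree.adj_of_common {n : ℕ} {G : SimpleGraph (Fin n)} (hG : EvenHoleFree G)
    {a a' x y : Fin n} (haa : a ≠ a') (hna : ¬ G.Adj a a') (hxy : x ≠ y)
    (hax : G.Adj a x) (hax' : G.Adj a' x) (hay : G.Adj a y) (hay' : G.Adj a' y) :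
    G.Adj x y := by
  by_contra hn
  have h1 := hax.ne
  have h2 := hax'.ne
  have h3 := hay.ne
  have h4 := hay'.ne
  refine hG.not_hole_seq (L := 4) le_rfl (by decide)
    (fun i => if i = 0 then a else if i = 1 then x else if i = 2 then a' else y) ?_ ?_
  · intro i j hij hj
    interval_cases j <;> interval_cases i <;> simp <;> tauto
  · intro i j hij hj
    interval_cases j <;> interval_cases i <;> simp [*, G.adj_comm]

theorem EvenHoleFree.card_common_le {n : ℕ} {G : SimpleGraph (Fin n)} (hG : EvenHoleFree G)
    {a a' : Fin n} (haa : a ≠ a') (hna : ¬ G.Adj a a') (K : Finset (Fin n))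
    (hK : ∀ x ∈ K, G.Adj a x ∧ G.Adj a' x) : K.card ≤ omegaNum G := by
  refine card_le_omegaNum G K fun x hx y hy hxy => ?_
  exact hG.adj_of_common haa hna hxy (hK x hx).1 (hK x hx).2 (hK y hy).1 (hK y hy).2

/-- The bipartite subgraph of `G` formed by the edges between `A` and `B`. -/
def bipartiteBetween {V : Type*} (G : SimpleGraph V) (A B : Set V) : SimpleGraph V where
  Adj u v := G.Adj u v ∧ (u ∈ A ∧ v ∈ B ∨ u ∈ B ∧ v ∈ A)
  symm := ⟨fun u v h => ⟨h.1.symm, by tauto⟩⟩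
  loopless := ⟨fun u h => G.loopless.irrefl u h.1⟩

theorem walk_parity {V : Type*} {G Γ : SimpleGraph V} {A B : Set V} (hdis : Disjoint A B)
    (hΓ : Γ ≤ bipartiteBetween G A B) {u v : V} (w : Γ.Walk u v) (hu : u ∈ A) :
    ∀ i ≤ w.length, (w.getVert i ∈ A ↔ Even i) ∧ (w.getVert i ∈ B ↔ Odd i) := by
  intro i
  have hd : ∀ x, x ∈ A → x ∈ B → False := fun x h1 h2 => Set.disjoint_left.1 hdis h1 h2
  induction i with
  | zero =>
    intro _
    simpa using ⟨hu, fun h => hd _ hu h⟩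
  | succ i ih =>
    intro hi
    have h1 := (hΓ (w.adj_getVert_succ (i := i) (by omega))).2
    have h2 := ih (by omega)
    have h3 := hd (w.getVert i)
    have h4 := hd (w.getVert (i + 1))
    rw [Nat.even_add_one, Nat.odd_add_one, Nat.not_even_iff_odd, Nat.not_odd_iff_even]
    tauto

theorem EvenHoleFree.isAcyclic_bipartiteBetween {n : ℕ} {G : SimpleGraph (Fin n)}
    (hG : EvenHoleFree G) {A B : Set (Fin n)} (hdis : Disjoint A B)
    (hA : ∀ x ∈ A, ∀ y ∈ A, ¬ G.Adj x y) (hB : ∀ x ∈ B, ∀ y ∈ B, ¬ G.Adj x y) :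
    (bipartiteBetween G A B).IsAcyclic := by
  rw [isAcyclic_iff_forall_adj_isBridge]
  suffices H : ∀ u v, u ∈ A → v ∈ B → (bipartiteBetween G A B).Adj u v →
      (bipartiteBetween G A B).IsBridge s(u, v) by
    intro u v huv
    rcases huv.2 with h | h
    · exact H u v h.1 h.2 huv
    · rw [Sym2.eq_swap]; exact H v u h.2 h.1 huv.symm
  intro u v hu hv huv
  rw [isBridge_iff]
  obtain ⟨Γ, hΓdef⟩ : ∃ Γ, Γ = (bipartiteBetween G A B).deleteEdges {s(u, v)} := ⟨_, rfl⟩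
  have hΓadj : ∀ x y, Γ.Adj x y ↔ (bipartiteBetween G A B).Adj x y ∧
      s(x, y) ∉ ({s(u, v)} : Set (Sym2 (Fin n))) := by
    intro x y; rw [hΓdef, deleteEdges_adj]
  rw [← hΓdef]
  intro hreach
  obtain ⟨w, hw⟩ := hreach.exists_walk_length_eq_dist
  have hΓ : Γ ≤ bipartiteBetween G A B := hΓdef ▸ deleteEdges_le _
  have hpar := walk_parity hdis hΓ w hu
  have hlen : Odd w.length := by
    rw [← (hpar _ le_rfl).2, w.getVert_length]; exact hv
  have hΓuv : ¬ Γ.Adj u v := by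
    simp [hΓdef]
  have hlen1 : w.length ≠ 1 := by
    intro h
    exact hΓuv (w.adj_of_length_eq_one h)
  have hmin : ∀ w' : Γ.Walk u v, w.length ≤ w'.length := fun w' => hw ▸ dist_le w'
  have hpath : w.IsPath := w.isPath_of_length_eq_dist hw
  refine hG.not_hole_seq (L := w.length + 1) (by rcases hlen with ⟨k, hk⟩; omega)
    (hlen.add_one) w.getVert ?_ ?_
  · intro i j hij hj h
    have := hpath.getVert_injOn (by simp; omega) (by simp; omega) h
    omega
  · intro i j hij hj
    constructor
    · intro hadj
      by_contra hcon
      push Not at hcon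
      have hi := hpar i (by omega)
      have hj' := hpar j (by omega)
      have hΓij : Γ.Adj (w.getVert i) (w.getVert j) := by
        refine (hΓadj _ _).2 ⟨⟨hadj, ?_⟩, ?_⟩
        · rcases Nat.even_or_odd i with h1 | h1 <;> rcases Nat.even_or_odd j with h2 | h2
          · exact absurd hadj (hA _ (hi.1.2 h1) _ (hj'.1.2 h2))
          · exact Or.inl ⟨hi.1.2 h1, hj'.2.2 h2⟩
          · exact Or.inr ⟨hi.2.2 h1, hj'.1.2 h2⟩
          · exact absurd hadj (hB _ (hi.2.2 h1) _ (hj'.2.2 h2))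
        · intro h1
          have hinj := hpath.getVert_injOn
          simp only [Set.mem_singleton_iff, Sym2.eq_iff] at h1
          rcases h1 with ⟨h1, h2⟩ | ⟨h1, h2⟩
          · have e1 := hinj (x₁ := i) (x₂ := 0) (by simp; omega) (by simp) (by simpa using h1)
            have e2 := hinj (x₁ := j) (x₂ := w.length) (by simp; omega) (by simp)
              (by simpa using h2)
            exact hcon.2 e1 (by omega)
          · have e2 := hinj (x₁ := j) (x₂ := 0) (by simp; omega) (by simp) (by simpa using h2)
            omega
      have := hmin ((w.take i).append (Walk.cons hΓij (w.drop j)))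
      simp only [Walk.length_append, Walk.length_cons, Walk.take_length, Walk.drop_length] at this
      have := hcon.1
      omega
    · rintro (rfl | ⟨rfl, hj2⟩)
      · exact (hΓ (w.adj_getVert_succ (by omega))).1
      · have : j = w.length := by omega
        subst this
        simpa using huv.1

theorem SimpleGraph.IsAcyclic.eq_of_adj_of_dist_eq {V : Type*} {Γ : SimpleGraph V}
    (hΓ : Γ.IsAcyclic) {r x y z : V} (hr : Γ.Reachable r x) (hy : Γ.Adj x y) (hz : Γ.Adj x z)
    (hdy : Γ.dist r x = Γ.dist r y + 1) (hdz : Γ.dist r x = Γ.dist r z + 1) : y = z := by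
  classical
  obtain ⟨p, hp, -⟩ := hr.exists_path_of_dist
  have key : ∀ y, Γ.Adj x y → Γ.dist r x = Γ.dist r y + 1 → y = p.penultimate := by
    intro y hy hd
    obtain ⟨q, hq, hq'⟩ := (hr.trans hy.reachable).exists_path_of_dist
    have hx : x ∉ q.support := by
      intro hx
      have h1 := dist_le (q.takeUntil x hx)
      have h2 := q.length_takeUntil_le_length hx
      omega
    exact hΓ.eq_penultimate_of_adj_end hp hy
      (hΓ.mem_support_of_ne_mem_support_of_adj_of_isPath hp hq hy hx)
  rw [key y hy hdy, key z hz hdz]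

theorem SimpleGraph.IsAcyclic.card_le_of_two_neighbors {V : Type*} {Γ : SimpleGraph V}
    (hΓ : Γ.IsAcyclic) (A B : Finset V)
    (hB : ∀ b ∈ B, ∃ a ∈ A, ∃ a' ∈ A, a ≠ a' ∧ Γ.Adj b a ∧ Γ.Adj b a') : B.card ≤ A.card := by
  classical
  let r : V → V := fun v => (Γ.connectedComponentMk v).out
  have hr : ∀ v, Γ.Reachable (r v) v := fun v =>
    ConnectedComponent.exact ((Γ.connectedComponentMk v).out_eq)
  have hradj : ∀ u v, Γ.Adj u v → r u = r v := fun u v h => by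
    simp only [r, ConnectedComponent.sound h.reachable]
  have hchild : ∀ b ∈ B, ∃ a ∈ A, Γ.Adj b a ∧ Γ.dist (r b) a = Γ.dist (r b) b + 1 := by
    intro b hb
    obtain ⟨a, ha, a', ha', hne, h1, h2⟩ := hB b hb
    rcases hΓ.dist_eq_dist_add_one_of_adj_of_reachable (r b) h1 (hr b) with h | h
    · rcases hΓ.dist_eq_dist_add_one_of_adj_of_reachable (r b) h2 (hr b) with h' | h'
      · exact absurd (hΓ.eq_of_adj_of_dist_eq (hr b) h1 h2 h h') hne
      · exact ⟨a', ha', h2, h'⟩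
    · exact ⟨a, ha, h1, h⟩
  choose! f hfA hfadj hfd using hchild
  refine Finset.card_le_card_of_injOn f hfA ?_
  intro b hb b' hb' heq
  have e1 := hradj _ _ (hfadj b hb)
  have e2 := hradj _ _ (hfadj b' hb')
  refine hΓ.eq_of_adj_of_dist_eq (r := r (f b)) (hr _) (hfadj b hb).symm ?_ ?_ ?_
  · exact heq ▸ (hfadj b' hb').symm
  · rw [← e1]; exact hfd b hb
  · rw [heq, ← e2]; exact hfd b' hb'

theorem EvenHoleFree.card_le_of_two_neighbors {n : ℕ} {G : SimpleGraph (Fin n)}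
    (hG : EvenHoleFree G) {A B : Finset (Fin n)} (hdis : Disjoint A B)
    (hA : ∀ x ∈ A, ∀ y ∈ A, ¬ G.Adj x y) (hB : ∀ x ∈ B, ∀ y ∈ B, ¬ G.Adj x y)
    (h2 : ∀ b ∈ B, ∃ a ∈ A, ∃ a' ∈ A, a ≠ a' ∧ G.Adj b a ∧ G.Adj b a') : B.card ≤ A.card := by
  refine (hG.isAcyclic_bipartiteBetween (A := (A : Set (Fin n))) (B := B)
    (by exact_mod_cast hdis) (by simpa using hA) (by simpa using hB)).card_le_of_two_neighbors
    A B ?_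
  intro b hb
  obtain ⟨a, ha, a', ha', hne, h1, h2⟩ := h2 b hb
  exact ⟨a, ha, a', ha', hne, ⟨h1, Or.inr ⟨hb, ha⟩⟩, ⟨h2, Or.inr ⟨hb, ha'⟩⟩⟩

theorem sq_card_le_mul_sum_not_adj {V : Type*} [DecidableEq V] (G : SimpleGraph V)
    [DecidableRel G.Adj] (t : ℕ) (K : Finset V)
    (hK : ∀ C ⊆ K, (∀ x ∈ C, ∀ y ∈ C, x ≠ y → G.Adj x y) → C.card ≤ t) :
    K.card ^ 2 ≤ t * ∑ x ∈ K, (K.filter fun y => ¬ G.Adj x y).card := by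
  induction t generalizing K with
  | zero =>
    rcases K.eq_empty_or_nonempty with rfl | ⟨w, hw⟩
    · simp
    · have := hK {w} (by simpa using hw) (by simp +contextual)
      simp at this
  | succ t ih =>
    rcases K.eq_empty_or_nonempty with rfl | hne
    · simp
    obtain ⟨w, hw, hmax⟩ := K.exists_max_image (fun w => (K.filter fun y => G.Adj w y).card) hne
    set M := K.filter fun y => G.Adj w y with hM
    have hMK : M ⊆ K := Finset.filter_subset _ _
    have hIH := ih M (by
      intro C hC hcl
      have hwC : w ∉ C := fun h => by simpa using (Finset.mem_filter.1 (hC h)).2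
      have := hK (insert w C) (by
        intro x hx
        rcases Finset.mem_insert.1 hx with rfl | hx
        · exact hw
        · exact hMK (hC hx)) (by
        intro x hx y hy hxy
        have hadj : ∀ z ∈ C, G.Adj w z := fun z hz => (Finset.mem_filter.1 (hC hz)).2
        rcases Finset.mem_insert.1 hx with hx' | hx' <;>
          rcases Finset.mem_insert.1 hy with hy' | hy'
        · exact absurd (hx'.trans hy'.symm) hxy
        · exact hx' ▸ hadj _ hy'
        · exact hy' ▸ (hadj _ hx').symm
        · exact hcl x hx' y hy' hxy)
      rw [Finset.card_insert_of_notMem hwC] at this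
      omega)
    have hdeg : ∀ x ∈ K, K.card - M.card ≤ (K.filter fun y => ¬ G.Adj x y).card := by
      intro x hx
      have h1 := hmax x hx
      have h2 := K.card_filter_add_card_filter_not (fun y => G.Adj x y)
      omega
    have hsplit := Finset.sum_sdiff (f := fun x => (K.filter fun y => ¬ G.Adj x y).card) hMK
    have h1 : (K.card - M.card) * (K.card - M.card) ≤
        ∑ x ∈ K \ M, (K.filter fun y => ¬ G.Adj x y).card := by
      have := Finset.card_nsmul_le_sum (K \ M) (fun x => (K.filter fun y => ¬ G.Adj x y).card)
        (K.card - M.card) (fun x hx => hdeg x (Finset.sdiff_subset hx))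
      rwa [Finset.card_sdiff_of_subset hMK, smul_eq_mul] at this
    have h2 : ∑ x ∈ M, (M.filter fun y => ¬ G.Adj x y).card ≤
        ∑ x ∈ M, (K.filter fun y => ¬ G.Adj x y).card :=
      Finset.sum_le_sum fun x _ => Finset.card_le_card (Finset.filter_subset_filter _ hMK)
    obtain ⟨s, hs⟩ := Nat.exists_eq_add_of_le (Finset.card_le_card hMK)
    rw [← hsplit]
    rw [hs, Nat.add_sub_cancel_left] at h1
    rw [hs]
    set k := M.card
    set NM := ∑ x ∈ M, (M.filter fun y => ¬ G.Adj x y).card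
    set P := ∑ x ∈ K \ M, (K.filter fun y => ¬ G.Adj x y).card
    set Q := ∑ x ∈ M, (K.filter fun y => ¬ G.Adj x y).card
    have h3 : 2 * k * s ≤ NM + t * (s * s) := by
      rcases Nat.eq_zero_or_pos t with rfl | ht
      · have : k = 0 := by nlinarith
        simp [this]
      · refine le_of_mul_le_mul_left (a := t) ?_ ht
        zify at hIH ⊢
        nlinarith [sq_nonneg ((k : ℤ) - t * s)]
    have h4 : (t + 1) * (s * s + NM) ≤ (t + 1) * (P + Q) :=
      Nat.mul_le_mul_left _ (Nat.add_le_add h1 h2)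
    nlinarith

theorem EvenHoleFree.sq_sum_degree_le {n : ℕ} {G : SimpleGraph (Fin n)} [DecidableRel G.Adj]
    (hG : EvenHoleFree G) (Q : Finset (Fin n)) :
    (∑ w ∈ Q, (Q.filter fun y => G.Adj w y).card) ^ 2 ≤
      omegaNum G * (omegaNum G + 1) * Q.card ^ 3 := by
  set t := omegaNum G
  have hcs := sq_sum_le_card_mul_sum_sq (s := Q)
    (f := fun w => (Q.filter fun y => G.Adj w y).card)
  have hT : ∀ w ∈ Q, (Q.filter fun y => G.Adj w y).card ^ 2 ≤
      t * ∑ x ∈ Q, (Q.filter fun y => G.Adj w x ∧ G.Adj w y ∧ ¬ G.Adj x y).card := by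
    intro w _
    refine (sq_card_le_mul_sum_not_adj G t _ fun C _ hC => card_le_omegaNum G C hC).trans ?_
    refine Nat.mul_le_mul_left _ ?_
    rw [Finset.sum_filter]
    refine Finset.sum_le_sum fun x _ => ?_
    split_ifs with h
    · rw [Finset.filter_filter]
      simp [h]
    · simp
  have hsum : ∑ w ∈ Q, ∑ x ∈ Q, (Q.filter fun y => G.Adj w x ∧ G.Adj w y ∧ ¬ G.Adj x y).card ≤
      (t + 1) * Q.card ^ 2 := by
    have hpair : ∀ x ∈ Q, ∑ y ∈ Q, (Q.filter fun w => G.Adj w x ∧ G.Adj w y ∧ ¬ G.Adj x y).card ≤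
        (t + 1) * Q.card := by
      intro x hx
      rw [← Finset.add_sum_erase _ _ hx, add_mul, one_mul, add_comm]
      refine Nat.add_le_add ?_ (Finset.card_filter_le _ _)
      have := Finset.sum_le_card_nsmul (Q.erase x)
        (fun y => (Q.filter fun w => G.Adj w x ∧ G.Adj w y ∧ ¬ G.Adj x y).card) t (by
          intro y hy
          by_cases hxy : G.Adj x y
          · simp [hxy]
          · refine hG.card_common_le (Finset.ne_of_mem_erase hy).symm hxy _ fun z hz => ?_
            have := (Finset.mem_filter.1 hz).2
            exact ⟨this.1.symm, this.2.1.symm⟩)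
      refine this.trans ?_
      rw [smul_eq_mul, mul_comm]
      exact Nat.mul_le_mul_left _ (Finset.card_le_card (Finset.erase_subset _ _))
    calc _ = ∑ x ∈ Q, ∑ y ∈ Q, (Q.filter fun w => G.Adj w x ∧ G.Adj w y ∧ ¬ G.Adj x y).card := by
          simp only [Finset.card_filter]
          rw [Finset.sum_comm]
          exact Finset.sum_congr rfl fun x _ => Finset.sum_comm
      _ ≤ Q.card • ((t + 1) * Q.card) := Finset.sum_le_card_nsmul _ _ _ hpair
      _ = _ := by rw [smul_eq_mul]; ring
  calc _ ≤ Q.card * ∑ w ∈ Q, (Q.filter fun y => G.Adj w y).card ^ 2 := hcs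
    _ ≤ Q.card * (t * ((t + 1) * Q.card ^ 2)) := by
        refine Nat.mul_le_mul_left _ ((Finset.sum_le_sum hT).trans ?_)
        rw [← Finset.mul_sum]
        exact Nat.mul_le_mul_left _ hsum
    _ = _ := by ring

theorem card_cylinder_mul_pow {V α : Type*} [Fintype V] [DecidableEq V] [Fintype α]
    [DecidableEq α] (Y : Finset V) (τ : V → α) :
    (Finset.univ.filter fun χ : V → α => ∀ y ∈ Y, χ y = τ y).card * Fintype.card α ^ Y.card =
      Fintype.card α ^ Fintype.card V := by
  have h : (Finset.univ.filter fun χ : V → α => ∀ y ∈ Y, χ y = τ y) =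
      Fintype.piFinset fun y => if y ∈ Y then {τ y} else Finset.univ := by
    ext χ
    simp only [Finset.mem_filter, Finset.mem_univ, true_and, Fintype.mem_piFinset]
    refine forall_congr' fun y => ?_
    split_ifs with hy <;> simp [hy]
  have h1 : Fintype.card α ^ Y.card = ∏ y : V, if y ∈ Y then Fintype.card α else 1 := by
    simp [Finset.prod_ite_mem]
  rw [h, Fintype.card_piFinset, h1, ← Finset.prod_mul_distrib, ← Finset.card_univ (α := V),
    ← Finset.prod_const]
  refine Finset.prod_congr rfl fun y _ => ?_
  split_ifs <;> simp

theorem card_mul_sq_le_of_sparse_selection {V ι : Type*} [Fintype V] [DecidableEq V]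
    (U : Finset V) (C : Finset ι) (a a' : ι → V) (X₁ : ι → Finset V) (X₂ : ι → Finset (V × V))
    (haa : ∀ z ∈ C, a z ≠ a' z) (haU : ∀ z ∈ C, a z ∈ U ∧ a' z ∈ U)
    (h₁ : ∀ z ∈ C, ∀ x ∈ X₁ z, x ≠ a z ∧ x ≠ a' z)
    (h₂ : ∀ z ∈ C, ∀ x ∈ X₂ z, x.1 ≠ x.2 ∧ x.1 ≠ a z ∧ x.1 ≠ a' z ∧ x.2 ≠ a z ∧ x.2 ≠ a' z)
    (hgood : ∀ A₀ ⊆ U, ∀ S ⊆ C, (∀ z ∈ S, a z ∈ A₀ ∧ a' z ∈ A₀ ∧ (∀ x ∈ X₁ z, x ∉ A₀) ∧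
      ∀ x ∈ X₂ z, ¬ (x.1 ∈ A₀ ∧ x.2 ∈ A₀)) → S.card ≤ 2 * A₀.card)
    (q : ℕ) (hq : 0 < q) :
    C.card * q ^ 2 ≤ 2 * U.card * q ^ 3 + q * ∑ z ∈ C, (X₁ z).card + ∑ z ∈ C, (X₂ z).card := by
  have : NeZero q := ⟨hq.ne'⟩
  have hcyl : ∀ Y : Finset V, (Finset.univ.filter fun χ : V → Fin q => ∀ y ∈ Y, χ y = 0).card *
      q ^ Y.card = q ^ Fintype.card V := by
    intro Y
    have := card_cylinder_mul_pow (α := Fin q) Y (fun _ => 0)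
    rwa [Fintype.card_fin] at this
  let c : Finset V → (V → Fin q) → ℕ := fun Y χ => if ∀ y ∈ Y, χ y = 0 then 1 else 0
  have hc : ∀ Y : Finset V, (∑ χ, c Y χ) * q ^ Y.card = q ^ Fintype.card V := by
    intro Y
    rw [← hcyl Y, Finset.card_filter]
  have hpt : ∀ χ : V → Fin q, ∑ z ∈ C, c {a z, a' z} χ ≤ 2 * ∑ x ∈ U, c {x} χ +
      ∑ z ∈ C, ∑ x ∈ X₁ z, c {a z, a' z, x} χ +
      ∑ z ∈ C, ∑ x ∈ X₂ z, c {a z, a' z, x.1, x.2} χ := by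
    intro χ
    set S := C.filter fun z => (χ (a z) = 0 ∧ χ (a' z) = 0) ∧ (∀ x ∈ X₁ z, χ x ≠ 0) ∧
      ∀ x ∈ X₂ z, ¬ (χ x.1 = 0 ∧ χ x.2 = 0) with hS
    have hS1 : S.card ≤ 2 * ∑ x ∈ U, c {x} χ := by
      have : ∑ x ∈ U, c {x} χ = (U.filter fun x => χ x = 0).card := by
        rw [Finset.card_filter]
        exact Finset.sum_congr rfl fun x _ => by simp [c]
      rw [this]
      refine hgood _ (Finset.filter_subset _ _) S (Finset.filter_subset _ _) fun z hz => ?_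
      obtain ⟨hzC, ⟨h1, h2⟩, h3, h4⟩ := Finset.mem_filter.1 hz
      refine ⟨Finset.mem_filter.2 ⟨(haU z hzC).1, h1⟩, Finset.mem_filter.2 ⟨(haU z hzC).2, h2⟩,
        fun x hx hx' => h3 x hx (Finset.mem_filter.1 hx').2, fun x hx hx' => h4 x hx
          ⟨(Finset.mem_filter.1 hx'.1).2, (Finset.mem_filter.1 hx'.2).2⟩⟩
    refine le_trans ?_ (Nat.add_le_add_right (Nat.add_le_add_right hS1 _) _)
    rw [hS, Finset.card_filter, ← Finset.sum_add_distrib, ← Finset.sum_add_distrib]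
    refine Finset.sum_le_sum fun z hz => ?_
    by_cases h0 : χ (a z) = 0 ∧ χ (a' z) = 0
    · have hle : c {a z, a' z} χ ≤ 1 := by simp only [c]; split_ifs <;> simp
      refine hle.trans ?_
      by_cases h1 : ∀ x ∈ X₁ z, χ x ≠ 0
      · by_cases h2 : ∀ x ∈ X₂ z, ¬ (χ x.1 = 0 ∧ χ x.2 = 0)
        · rw [if_pos ⟨h0, h1, h2⟩]; omega
        · push Not at h2
          obtain ⟨x, hx, hx'⟩ := h2
          have h3 : c {a z, a' z, x.1, x.2} χ = 1 := by simp [c, h0, hx']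
          have := Finset.single_le_sum (f := fun x : V × V => c {a z, a' z, x.1, x.2} χ)
            (fun _ _ => Nat.zero_le _) hx
          simp only [h3] at this
          omega
      · push Not at h1
        obtain ⟨x, hx, hx'⟩ := h1
        have h3 : c {a z, a' z, x} χ = 1 := by simp [c, h0, hx']
        have := Finset.single_le_sum (f := fun x : V => c {a z, a' z, x} χ)
          (fun _ _ => Nat.zero_le _) hx
        simp only [h3] at this
        omega
    · have : c {a z, a' z} χ = 0 := by
        simp only [c]
        rw [if_neg]
        simpa using h0
      omega
  have hsum := Finset.sum_le_sum (s := Finset.univ) fun χ _ => hpt χ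
  have e0 : (∑ χ, ∑ z ∈ C, c {a z, a' z} χ) * q ^ 2 = C.card * q ^ Fintype.card V := by
    rw [Finset.sum_comm, Finset.sum_mul, ← smul_eq_mul, ← Finset.sum_const]
    refine Finset.sum_congr rfl fun z hz => ?_
    rw [← hc {a z, a' z}, Finset.card_pair (haa z hz)]
  have e1 : (∑ χ, ∑ x ∈ U, c {x} χ) * q = U.card * q ^ Fintype.card V := by
    rw [Finset.sum_comm, Finset.sum_mul, ← smul_eq_mul, ← Finset.sum_const]
    refine Finset.sum_congr rfl fun x hx => ?_
    rw [← hc {x}, Finset.card_singleton, pow_one]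
  have e2 : (∑ χ, ∑ z ∈ C, ∑ x ∈ X₁ z, c {a z, a' z, x} χ) * q ^ 3 =
      (∑ z ∈ C, (X₁ z).card) * q ^ Fintype.card V := by
    rw [Finset.sum_comm, Finset.sum_mul, Finset.sum_mul]
    refine Finset.sum_congr rfl fun z hz => ?_
    rw [Finset.sum_comm, Finset.sum_mul, ← smul_eq_mul, ← Finset.sum_const]
    refine Finset.sum_congr rfl fun x hx => ?_
    have := h₁ z hz x hx
    rw [← hc {a z, a' z, x}, Finset.card_eq_three.2 ⟨a z, a' z, x, haa z hz, this.1.symm,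
      this.2.symm, rfl⟩]
  have e3 : (∑ χ, ∑ z ∈ C, ∑ x ∈ X₂ z, c {a z, a' z, x.1, x.2} χ) * q ^ 4 =
      (∑ z ∈ C, (X₂ z).card) * q ^ Fintype.card V := by
    rw [Finset.sum_comm, Finset.sum_mul, Finset.sum_mul]
    refine Finset.sum_congr rfl fun z hz => ?_
    rw [Finset.sum_comm, Finset.sum_mul, ← smul_eq_mul, ← Finset.sum_const]
    refine Finset.sum_congr rfl fun x hx => ?_
    obtain ⟨g1, g2, g3, g4, g5⟩ := h₂ z hz x hx
    have hcard : ({a z, a' z, x.1, x.2} : Finset V).card = 4 := by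
      rw [Finset.card_insert_of_notMem, Finset.card_insert_of_notMem, Finset.card_pair g1]
      · simp [g3.symm, g5.symm]
      · simp [haa z hz, g2.symm, g4.symm]
    rw [← hc {a z, a' z, x.1, x.2}, hcard]
  simp only [Finset.sum_add_distrib, ← Finset.mul_sum] at hsum
  have hqn : 0 < q ^ Fintype.card V := pow_pos hq _
  refine le_of_mul_le_mul_right (a := q ^ Fintype.card V * q ^ 2) ?_ (by positivity)
  have := Nat.mul_le_mul_right (q ^ 4) hsum
  calc _ = (∑ χ, ∑ z ∈ C, c {a z, a' z} χ) * q ^ 2 * q ^ 4 := by rw [e0]; ring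
    _ = (∑ χ, ∑ z ∈ C, c {a z, a' z} χ) * q ^ 4 * q ^ 2 := by ring
    _ ≤ _ := Nat.mul_le_mul_right (q ^ 2) this
    _ = (2 * ((∑ χ, ∑ x ∈ U, c {x} χ) * q) * q ^ 3 +
        (∑ χ, ∑ z ∈ C, ∑ x ∈ X₁ z, c {a z, a' z, x} χ) * q ^ 3 * q +
        (∑ χ, ∑ z ∈ C, ∑ x ∈ X₂ z, c {a z, a' z, x.1, x.2} χ) * q ^ 4) * q ^ 2 := by ring
    _ = _ := by rw [e1, e2, e3]; ring

/-- The neighbours of `v` in `U` that precede `v` in the order given by `ord`. -/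
def backNbrs {V : Type*} (G : SimpleGraph V) [DecidableRel G.Adj] (ord : V → ℕ)
    (U : Finset V) (v : V) : Finset V :=
  U.filter fun u => G.Adj v u ∧ ord u < ord v

/-- Triples `(v, a, a')` with `a, a'` distinct nonadjacent back-neighbours of `v`. -/
def cherries {V : Type*} [DecidableEq V] (G : SimpleGraph V) [DecidableRel G.Adj] (ord : V → ℕ)
    (U : Finset V) : Finset (V × V × V) :=
  (U ×ˢ U ×ˢ U).filter fun z => z.2.1 ∈ backNbrs G ord U z.1 ∧ z.2.2 ∈ backNbrs G ord U z.1 ∧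
    z.2.1 ≠ z.2.2 ∧ ¬ G.Adj z.2.1 z.2.2

/-- The cherries `(v, a, a')` such that no back-neighbour of `v` has both `a` and `a'` as
back-neighbours. -/
def minCherries {V : Type*} [DecidableEq V] (G : SimpleGraph V) [DecidableRel G.Adj]
    (ord : V → ℕ) (U : Finset V) : Finset (V × V × V) :=
  (cherries G ord U).filter fun z => ∀ u ∈ backNbrs G ord U z.1,
    ¬ (z.2.1 ∈ backNbrs G ord U u ∧ z.2.2 ∈ backNbrs G ord U u)

/-- The vertices that must not be selected for the cherry `z` to be good. -/
def forbiddenVerts {V : Type*} [DecidableEq V] (G : SimpleGraph V) [DecidableRel G.Adj]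
    (ord : V → ℕ) (U : Finset V) (z : V × V × V) : Finset V :=
  (backNbrs G ord U z.2.1 ∪ (backNbrs G ord U z.2.2 ∪ (backNbrs G ord U z.1 ∪ ({z.1} ∪
    ((backNbrs G ord U z.1).filter fun u => z.2.1 ∈ backNbrs G ord U u ∨
      z.2.2 ∈ backNbrs G ord U u).biUnion (backNbrs G ord U))))) \ {z.2.1, z.2.2}

/-- The pairs of vertices that must not be simultaneously selected for the cherry `z` to be
good. -/
def forbiddenPairs {V : Type*} [DecidableEq V] (G : SimpleGraph V) [DecidableRel G.Adj]
    (ord : V → ℕ) (U : Finset V) (z : V × V × V) : Finset (V × V) :=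
  ((backNbrs G ord U z.1).biUnion fun u => backNbrs G ord U u ×ˢ backNbrs G ord U u).filter
    fun x => x.1 ≠ x.2 ∧ x.1 ≠ z.2.1 ∧ x.1 ≠ z.2.2 ∧ x.2 ≠ z.2.1 ∧ x.2 ≠ z.2.2

theorem mem_backNbrs {V : Type*} {G : SimpleGraph V} [DecidableRel G.Adj] {ord : V → ℕ}
    {U : Finset V} {v u : V} :
    u ∈ backNbrs G ord U v ↔ u ∈ U ∧ G.Adj v u ∧ ord u < ord v :=
  Finset.mem_filter

theorem mem_cherries {V : Type*} [DecidableEq V] {G : SimpleGraph V} [DecidableRel G.Adj]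
    {ord : V → ℕ} {U : Finset V} {z : V × V × V} :
    z ∈ cherries G ord U ↔ z.1 ∈ U ∧ z.2.1 ∈ backNbrs G ord U z.1 ∧
      z.2.2 ∈ backNbrs G ord U z.1 ∧ z.2.1 ≠ z.2.2 ∧ ¬ G.Adj z.2.1 z.2.2 := by
  simp only [cherries, Finset.mem_filter, Finset.mem_product, mem_backNbrs]
  tauto

theorem mem_minCherries {V : Type*} [DecidableEq V] {G : SimpleGraph V} [DecidableRel G.Adj]
    {ord : V → ℕ} {U : Finset V} {z : V × V × V} :
    z ∈ minCherries G ord U ↔ z ∈ cherries G ord U ∧ ∀ u ∈ backNbrs G ord U z.1,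
      ¬ (z.2.1 ∈ backNbrs G ord U u ∧ z.2.2 ∈ backNbrs G ord U u) :=
  Finset.mem_filter

theorem EvenHoleFree.card_good_cherries_le {n : ℕ} {G : SimpleGraph (Fin n)} [DecidableRel G.Adj]
    (hG : EvenHoleFree G) {ord : Fin n → ℕ} (hord : Function.Injective ord) {U : Finset (Fin n)}
    {A₀ : Finset (Fin n)} (hA₀ : A₀ ⊆ U) {S : Finset (Fin n × Fin n × Fin n)}
    (hS : S ⊆ minCherries G ord U)
    (hgood : ∀ z ∈ S, z.2.1 ∈ A₀ ∧ z.2.2 ∈ A₀ ∧ (∀ x ∈ forbiddenVerts G ord U z, x ∉ A₀) ∧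
      ∀ x ∈ forbiddenPairs G ord U z, ¬ (x.1 ∈ A₀ ∧ x.2 ∈ A₀)) :
    S.card ≤ 2 * A₀.card := by
  have hmin : ∀ z ∈ S, (z.1 ∈ U ∧ z.2.1 ∈ backNbrs G ord U z.1 ∧
      z.2.2 ∈ backNbrs G ord U z.1 ∧ z.2.1 ≠ z.2.2 ∧ ¬ G.Adj z.2.1 z.2.2) ∧
      ∀ u ∈ backNbrs G ord U z.1,
        ¬ (z.2.1 ∈ backNbrs G ord U u ∧ z.2.2 ∈ backNbrs G ord U u) := by
    intro z hz
    have := mem_minCherries.1 (hS hz)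
    exact ⟨mem_cherries.1 this.1, this.2⟩
  have hF : ∀ z ∈ S, ∀ x, x ≠ z.2.1 → x ≠ z.2.2 → (x ∈ backNbrs G ord U z.2.1 ∨
      x ∈ backNbrs G ord U z.2.2 ∨ x ∈ backNbrs G ord U z.1 ∨ x = z.1 ∨
      ∃ u ∈ backNbrs G ord U z.1, (z.2.1 ∈ backNbrs G ord U u ∨ z.2.2 ∈ backNbrs G ord U u) ∧
        x ∈ backNbrs G ord U u) → x ∉ A₀ := by
    intro z hz x h1 h2 h
    refine (hgood z hz).2.2.1 x ?_
    simp only [forbiddenVerts, Finset.mem_sdiff, Finset.mem_union, Finset.mem_singleton,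
      Finset.mem_biUnion, Finset.mem_filter, Finset.mem_insert]
    refine ⟨?_, by tauto⟩
    rcases h with h | h | h | h | ⟨u, hu, hu', hx⟩
    · tauto
    · tauto
    · tauto
    · tauto
    · exact Or.inr (Or.inr (Or.inr (Or.inr ⟨u, ⟨hu, hu'⟩, hx⟩)))
  have hback : ∀ z ∈ S, ∀ x ∈ A₀, x ∈ backNbrs G ord U z.1 → x = z.2.1 ∨ x = z.2.2 := by
    intro z hz x hxA hx
    by_contra hcon
    push Not at hcon
    exact hF z hz x hcon.1 hcon.2 (by tauto) hxA
  have hirr : ∀ v, v ∉ backNbrs G ord U v := fun v h => (mem_backNbrs.1 h).2.1.ne rfl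
  set A := A₀.filter fun x => ∀ y ∈ backNbrs G ord U x, y ∉ A₀ with hA
  set B := S.image fun z => z.1 with hB
  have hBA₀ : ∀ v ∈ B, v ∉ A₀ := by
    intro v hv
    obtain ⟨z, hz, rfl⟩ := Finset.mem_image.1 hv
    have := (hmin z hz).1
    exact hF z hz _ (fun h => hirr _ (h ▸ this.2.1)) (fun h => hirr _ (h ▸ this.2.2.1)) (by tauto)
  have hzA : ∀ z ∈ S, z.2.1 ∈ A ∧ z.2.2 ∈ A := by
    intro z hz
    have hz' := (hmin z hz).1
    have hg := hgood z hz
    constructor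
    · refine Finset.mem_filter.2 ⟨hg.1, fun y hy => hF z hz y ?_ ?_ (Or.inl hy)⟩
      · rintro rfl; exact hirr _ hy
      · rintro rfl; exact hz'.2.2.2.2 (mem_backNbrs.1 hy).2.1
    · refine Finset.mem_filter.2 ⟨hg.2.1, fun y hy => hF z hz y ?_ ?_ (Or.inr (Or.inl hy))⟩
      · rintro rfl; exact hz'.2.2.2.2 (mem_backNbrs.1 hy).2.1.symm
      · rintro rfl; exact hirr _ hy
  have hAind : ∀ x ∈ A, ∀ y ∈ A, ¬ G.Adj x y := by
    intro x hx y hy hxy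
    have hx' := Finset.mem_filter.1 hx
    have hy' := Finset.mem_filter.1 hy
    rcases lt_trichotomy (ord x) (ord y) with h | h | h
    · exact hy'.2 x (mem_backNbrs.2 ⟨hA₀ hx'.1, hxy.symm, h⟩) hx'.1
    · exact hxy.ne (hord h)
    · exact hx'.2 y (mem_backNbrs.2 ⟨hA₀ hy'.1, hxy, h⟩) hy'.1
  have hBind' : ∀ z ∈ S, ∀ w ∈ S, G.Adj z.1 w.1 → ord w.1 < ord z.1 → False := by
    intro z hz w hw hadj hlt
    have hz' := hmin z hz
    have hw' := hmin w hw
    have hgw := hgood w hw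
    have hu : w.1 ∈ backNbrs G ord U z.1 := mem_backNbrs.2 ⟨hw'.1.1, hadj, hlt⟩
    have h1 := hw'.1.2.1
    have h2 := hw'.1.2.2.1
    have hne := hw'.1.2.2.2.1
    have hmn := hz'.2 _ hu
    by_cases c1 : w.2.1 = z.2.1 ∨ w.2.1 = z.2.2
    · by_cases c2 : w.2.2 = z.2.1 ∨ w.2.2 = z.2.2
      · rcases c1 with c1 | c1 <;> rcases c2 with c2 | c2
        · exact hne (c1.trans c2.symm)
        · exact hmn ⟨c1 ▸ h1, c2 ▸ h2⟩
        · exact hmn ⟨c2 ▸ h2, c1 ▸ h1⟩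
        · exact hne (c1.trans c2.symm)
      · push Not at c2
        refine hF z hz _ c2.1 c2.2 (Or.inr (Or.inr (Or.inr (Or.inr ⟨_, hu, ?_, h2⟩)))) hgw.2.1
        rcases c1 with c1 | c1
        · exact Or.inl (c1 ▸ h1)
        · exact Or.inr (c1 ▸ h1)
    · push Not at c1
      by_cases c2 : w.2.2 = z.2.1 ∨ w.2.2 = z.2.2
      · refine hF z hz _ c1.1 c1.2 (Or.inr (Or.inr (Or.inr (Or.inr ⟨_, hu, ?_, h1⟩)))) hgw.1
        rcases c2 with c2 | c2
        · exact Or.inl (c2 ▸ h2)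
        · exact Or.inr (c2 ▸ h2)
      · push Not at c2
        refine (hgood z hz).2.2.2 (w.2.1, w.2.2) ?_ ⟨hgw.1, hgw.2.1⟩
        simp only [forbiddenPairs, Finset.mem_filter, Finset.mem_biUnion, Finset.mem_product]
        exact ⟨⟨_, hu, h1, h2⟩, hne, c1.1, c1.2, c2.1, c2.2⟩
  have hBind : ∀ x ∈ B, ∀ y ∈ B, ¬ G.Adj x y := by
    intro x hx y hy hxy
    obtain ⟨z, hz, rfl⟩ := Finset.mem_image.1 hx
    obtain ⟨w, hw, rfl⟩ := Finset.mem_image.1 hy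
    rcases lt_trichotomy (ord w.1) (ord z.1) with h | h | h
    · exact hBind' z hz w hw hxy h
    · exact hxy.ne (hord h).symm
    · exact hBind' w hw z hz hxy.symm h
  have hBA : B.card ≤ A.card := by
    refine hG.card_le_of_two_neighbors ?_ hAind hBind ?_
    · rw [Finset.disjoint_left]
      exact fun x hx hxB => hBA₀ x hxB (Finset.mem_filter.1 hx).1
    · intro b hb
      obtain ⟨z, hz, rfl⟩ := Finset.mem_image.1 hb
      have hz' := (hmin z hz).1
      exact ⟨_, (hzA z hz).1, _, (hzA z hz).2, hz'.2.2.2.1, (mem_backNbrs.1 hz'.2.1).2.1,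
        (mem_backNbrs.1 hz'.2.2.1).2.1⟩
  have hSB : S.card ≤ 2 * B.card := by
    refine Finset.card_le_mul_card_image S 2 fun v hv => ?_
    obtain ⟨z, hz, rfl⟩ := Finset.mem_image.1 hv
    refine (Finset.card_le_card (t := {z, (z.1, z.2.2, z.2.1)}) ?_).trans Finset.card_le_two
    intro w hw
    obtain ⟨hwS, hwz⟩ := Finset.mem_filter.1 hw
    have hw' := (hmin w hwS).1
    have hgw := hgood w hwS
    have h1 := hback z hz _ hgw.1 (hwz ▸ hw'.2.1)
    have h2 := hback z hz _ hgw.2.1 (hwz ▸ hw'.2.2.1)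
    have hne := hw'.2.2.2.1
    rw [Finset.mem_insert, Finset.mem_singleton]
    rcases h1 with e1 | e1 <;> rcases h2 with e2 | e2
    · exact absurd (e1.trans e2.symm) hne
    · exact Or.inl (Prod.ext hwz (Prod.ext e1 e2))
    · exact Or.inr (Prod.ext hwz (Prod.ext e1 e2))
    · exact absurd (e1.trans e2.symm) hne
  have hAA : A.card ≤ A₀.card := Finset.card_filter_le _ _
  omega

/-- The number of ordered adjacent pairs among the back-neighbours of `v`. -/
def backEdges {V : Type*} (G : SimpleGraph V) [DecidableRel G.Adj] (ord : V → ℕ)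
    (U : Finset V) (v : V) : ℕ :=
  ∑ w ∈ backNbrs G ord U v, ((backNbrs G ord U v).filter fun y => G.Adj w y).card

theorem sum_sq_card_backNbrs_le {V : Type*} [DecidableEq V] (G : SimpleGraph V)
    [DecidableRel G.Adj] (ord : V → ℕ) (U : Finset V) :
    ∑ v ∈ U, (backNbrs G ord U v).card ^ 2 ≤ (cherries G ord U).card +
      ∑ v ∈ U, (backNbrs G ord U v).card + ∑ v ∈ U, backEdges G ord U v := by
  rw [Finset.card_eq_sum_card_fiberwise (f := fun z : V × V × V => z.1) (t := U)
    (fun z hz => (mem_cherries.1 hz).1), ← Finset.sum_add_distrib, ← Finset.sum_add_distrib]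
  refine Finset.sum_le_sum fun v hv => ?_
  set Q := backNbrs G ord U v with hQ
  have h1 := (Q ×ˢ Q).card_filter_add_card_filter_not (fun p => p.1 ≠ p.2 ∧ ¬ G.Adj p.1 p.2)
  rw [Finset.card_product, ← sq] at h1
  have h2 : ((Q ×ˢ Q).filter fun p => p.1 ≠ p.2 ∧ ¬ G.Adj p.1 p.2).card ≤
      ((cherries G ord U).filter fun z => z.1 = v).card := by
    refine Finset.card_le_card_of_injOn (fun p => (v, p)) ?_ ?_
    · intro p hp
      have hp' := Finset.mem_filter.1 hp
      have := Finset.mem_product.1 hp'.1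
      exact Finset.mem_filter.2 ⟨mem_cherries.2 ⟨hv, this.1, this.2, hp'.2⟩, rfl⟩
    · intro p _ p' _ h
      exact (Prod.mk.inj h).2
  have h3 : ((Q ×ˢ Q).filter fun p => ¬ (p.1 ≠ p.2 ∧ ¬ G.Adj p.1 p.2)).card ≤
      Q.card + backEdges G ord U v := by
    have : ((Q ×ˢ Q).filter fun p => ¬ (p.1 ≠ p.2 ∧ ¬ G.Adj p.1 p.2)) ⊆
        Q.diag ∪ (Q ×ˢ Q).filter fun p => G.Adj p.1 p.2 := by
      intro p hp
      simp only [Finset.mem_filter, Finset.mem_product, Finset.mem_union, Finset.mem_diag] at hp ⊢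
      tauto
    refine (Finset.card_le_card this).trans ((Finset.card_union_le _ _).trans ?_)
    rw [Finset.diag_card]
    refine Nat.add_le_add_left (le_of_eq ?_) _
    rw [backEdges, Finset.card_filter, Finset.sum_product]
    exact Finset.sum_congr rfl fun x _ => (Finset.card_filter _ _).symm
  omega

theorem EvenHoleFree.card_cherries_le {n : ℕ} {G : SimpleGraph (Fin n)} [DecidableRel G.Adj]
    (hG : EvenHoleFree G) (ord : Fin n → ℕ) (U : Finset (Fin n)) :
    (cherries G ord U).card ≤ omegaNum G * (minCherries G ord U).card := by
  have h1 := Finset.card_le_mul_card_image (f := fun z : Fin n × Fin n × Fin n => z.2)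
    (cherries G ord U) (omegaNum G) (by
      intro p hp
      obtain ⟨z, hz, rfl⟩ := Finset.mem_image.1 hp
      have hz' := mem_cherries.1 hz
      have hle : ((cherries G ord U).filter fun x => x.2 = z.2).card ≤
          (((cherries G ord U).filter fun x => x.2 = z.2).image fun x => x.1).card := by
        refine le_of_eq (Finset.card_image_of_injOn ?_).symm
        intro x hx y hy hxy
        have hx' := (Finset.mem_filter.1 hx).2
        have hy' := (Finset.mem_filter.1 hy).2
        exact Prod.ext hxy (hx'.trans hy'.symm)
      refine hle.trans (hG.card_common_le hz'.2.2.2.1 hz'.2.2.2.2 _ ?_)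
      intro x hx
      obtain ⟨w, hw, rfl⟩ := Finset.mem_image.1 hx
      obtain ⟨hw1, hw2⟩ := Finset.mem_filter.1 hw
      have hw' := mem_cherries.1 hw1
      rw [← hw2]
      exact ⟨(mem_backNbrs.1 hw'.2.1).2.1.symm, (mem_backNbrs.1 hw'.2.2.1).2.1.symm⟩)
  refine h1.trans (Nat.mul_le_mul_left _ ?_)
  refine (Finset.card_le_card ?_).trans
    (Finset.card_image_le (s := minCherries G ord U) (f := fun z : Fin n × Fin n × Fin n => z.2))
  intro p hp
  obtain ⟨z, hz, rfl⟩ := Finset.mem_image.1 hp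
  obtain ⟨w, hw, hmin⟩ := ((cherries G ord U).filter fun x => x.2 = z.2).exists_min_image
    (fun x => ord x.1) ⟨z, Finset.mem_filter.2 ⟨hz, rfl⟩⟩
  obtain ⟨hw1, hw2⟩ := Finset.mem_filter.1 hw
  have hw' := mem_cherries.1 hw1
  refine Finset.mem_image.2 ⟨w, mem_minCherries.2 ⟨hw1, ?_⟩, hw2⟩
  rintro u hu ⟨h1, h2⟩
  have hu' := mem_backNbrs.1 hu
  have := hmin (u, w.2) (Finset.mem_filter.2 ⟨mem_cherries.2 ⟨hu'.1, h1, h2, hw'.2.2.2⟩, hw2⟩)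
  exact absurd hu'.2.2 (not_lt.2 this)

theorem sum_card_forbiddenPairs_le {V : Type*} [DecidableEq V] {G : SimpleGraph V}
    [DecidableRel G.Adj] {ord : V → ℕ} {U : Finset V} {D : ℕ}
    (hD : ∀ v ∈ U, (backNbrs G ord U v).card ≤ D) :
    ∑ z ∈ minCherries G ord U, (forbiddenPairs G ord U z).card ≤
      (minCherries G ord U).card * D ^ 3 := by
  rw [← smul_eq_mul]
  refine Finset.sum_le_card_nsmul _ _ _ fun z hz => ?_
  have hz' := mem_cherries.1 (mem_minCherries.1 hz).1
  refine (Finset.card_filter_le _ _).trans (Finset.card_biUnion_le.trans ?_)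
  have : ∀ u ∈ backNbrs G ord U z.1,
      (backNbrs G ord U u ×ˢ backNbrs G ord U u).card ≤ D * D := by
    intro u hu
    rw [Finset.card_product]
    have := hD u (mem_backNbrs.1 hu).1
    exact Nat.mul_le_mul this this
  refine (Finset.sum_le_card_nsmul _ _ _ this).trans ?_
  rw [smul_eq_mul]
  calc _ ≤ D * (D * D) := Nat.mul_le_mul_right _ (hD _ hz'.1)
    _ = D ^ 3 := by ring

theorem sum_minCherries_le {V : Type*} [DecidableEq V] (G : SimpleGraph V)
    [DecidableRel G.Adj] (ord : V → ℕ) (U : Finset V) (f : V × V × V → ℕ) :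
    ∑ z ∈ minCherries G ord U, f z ≤
      ∑ v ∈ U, ∑ a ∈ backNbrs G ord U v, ∑ a' ∈ backNbrs G ord U v, f (v, a, a') := by
  rw [← Finset.sum_fiberwise_of_maps_to (s := minCherries G ord U) (t := U)
    (g := fun z : V × V × V => z.1)
    (fun z hz => (mem_cherries.1 (mem_minCherries.1 hz).1).1)]
  refine Finset.sum_le_sum fun v _ => ?_
  have hsub : ((minCherries G ord U).filter fun z => z.1 = v) ⊆
      {v} ×ˢ (backNbrs G ord U v ×ˢ backNbrs G ord U v) := by
    intro z hz
    obtain ⟨h1, h2⟩ := Finset.mem_filter.1 hz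
    have hz' := mem_cherries.1 (mem_minCherries.1 h1).1
    rw [h2] at hz'
    simp only [Finset.mem_product, Finset.mem_singleton]
    exact ⟨h2, hz'.2.1, hz'.2.2.1⟩
  refine (Finset.sum_le_sum_of_subset hsub).trans (le_of_eq ?_)
  rw [Finset.sum_product, Finset.sum_singleton, Finset.sum_product]

theorem sum_card_forbiddenVerts_le {V : Type*} [DecidableEq V] {G : SimpleGraph V}
    [DecidableRel G.Adj] {ord : V → ℕ} {U : Finset V} {D : ℕ}
    (hD : ∀ v ∈ U, (backNbrs G ord U v).card ≤ D) :
    ∑ z ∈ minCherries G ord U, (forbiddenVerts G ord U z).card ≤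
      (minCherries G ord U).card * (3 * D + 1) + 2 * D ^ 2 * ∑ v ∈ U, backEdges G ord U v := by
  have h1 : ∀ z ∈ minCherries G ord U, (forbiddenVerts G ord U z).card ≤ (3 * D + 1) +
      D * ((backNbrs G ord U z.1).filter fun u => z.2.1 ∈ backNbrs G ord U u ∨
        z.2.2 ∈ backNbrs G ord U u).card := by
    intro z hz
    have hz' := mem_cherries.1 (mem_minCherries.1 hz).1
    have e1 := hD _ hz'.1
    have e2 := hD _ (mem_backNbrs.1 hz'.2.1).1
    have e3 := hD _ (mem_backNbrs.1 hz'.2.2.1).1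
    have e4 : (((backNbrs G ord U z.1).filter fun u => z.2.1 ∈ backNbrs G ord U u ∨
        z.2.2 ∈ backNbrs G ord U u).biUnion (backNbrs G ord U)).card ≤
        D * ((backNbrs G ord U z.1).filter fun u => z.2.1 ∈ backNbrs G ord U u ∨
        z.2.2 ∈ backNbrs G ord U u).card := by
      rw [mul_comm]
      exact Finset.card_biUnion_le_card_mul _ _ _ fun u hu =>
        hD u (mem_backNbrs.1 (Finset.mem_filter.1 hu).1).1
    refine (Finset.card_le_card Finset.sdiff_subset).trans ?_
    refine (Finset.card_union_le _ _).trans ?_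
    have f1 := Finset.card_union_le (backNbrs G ord U z.2.2) (backNbrs G ord U z.1 ∪ ({z.1} ∪
      ((backNbrs G ord U z.1).filter fun u => z.2.1 ∈ backNbrs G ord U u ∨
        z.2.2 ∈ backNbrs G ord U u).biUnion (backNbrs G ord U)))
    have f2 := Finset.card_union_le (backNbrs G ord U z.1) ({z.1} ∪
      ((backNbrs G ord U z.1).filter fun u => z.2.1 ∈ backNbrs G ord U u ∨
        z.2.2 ∈ backNbrs G ord U u).biUnion (backNbrs G ord U))
    have f3 := Finset.card_union_le {z.1}
      (((backNbrs G ord U z.1).filter fun u => z.2.1 ∈ backNbrs G ord U u ∨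
        z.2.2 ∈ backNbrs G ord U u).biUnion (backNbrs G ord U))
    rw [Finset.card_singleton] at f3
    omega
  refine (Finset.sum_le_sum h1).trans ?_
  rw [Finset.sum_add_distrib, Finset.sum_const, smul_eq_mul, ← Finset.mul_sum]
  refine Nat.add_le_add_left ?_ _
  have h2 : ∑ z ∈ minCherries G ord U, ((backNbrs G ord U z.1).filter fun u =>
      z.2.1 ∈ backNbrs G ord U u ∨ z.2.2 ∈ backNbrs G ord U u).card ≤
      2 * D * ∑ v ∈ U, backEdges G ord U v := by
    refine (sum_minCherries_le G ord U _).trans ?_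
    rw [Finset.mul_sum]
    refine Finset.sum_le_sum fun v hv => ?_
    set Q := backNbrs G ord U v with hQ
    have h3 : ∀ a ∈ Q, ∀ a' ∈ Q, (Q.filter fun u => a ∈ backNbrs G ord U u ∨
        a' ∈ backNbrs G ord U u).card ≤
        (Q.filter fun y => G.Adj a y).card + (Q.filter fun y => G.Adj a' y).card := by
      intro a _ a' _
      refine (Finset.card_le_card ?_).trans (Finset.card_union_le _ _)
      intro u hu
      obtain ⟨h4, h5⟩ := Finset.mem_filter.1 hu
      rw [Finset.mem_union, Finset.mem_filter, Finset.mem_filter]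
      rcases h5 with h5 | h5
      · exact Or.inl ⟨h4, (mem_backNbrs.1 h5).2.1.symm⟩
      · exact Or.inr ⟨h4, (mem_backNbrs.1 h5).2.1.symm⟩
    refine (Finset.sum_le_sum fun a ha => Finset.sum_le_sum fun a' ha' => h3 a ha a' ha').trans ?_
    simp only [Finset.sum_add_distrib, Finset.sum_const, smul_eq_mul, ← Finset.mul_sum]
    have h6 : ∑ w ∈ Q, (Q.filter fun y => G.Adj w y).card = backEdges G ord U v := rfl
    rw [h6]
    have := Nat.mul_le_mul_right (backEdges G ord U v) (hD v hv)
    rw [← hQ] at this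
    linarith
  calc _ ≤ D * (2 * D * ∑ v ∈ U, backEdges G ord U v) := Nat.mul_le_mul_left _ h2
    _ = _ := by ring

theorem false_of_dense_counts {t D N C S₁ S₂ M X₁ X₂ All : ℕ} (ht : 0 < t) (hN : 0 < N)
    (hD : 2 ^ 26 * (t + 1) ^ 6 ≤ D) (hAll : S₂ ≤ All + S₁ + M) (hcs : S₁ ^ 2 ≤ N * S₂)
    (hlow : D * N ≤ 2 * S₁) (hup : S₁ ≤ N * D) (hM : 2 ^ 13 * t ^ 2 * M ≤ N * D ^ 2)
    (hC : All ≤ t * C) (hX₁ : X₁ ≤ C * (3 * D + 1) + 2 * D ^ 2 * M) (hX₂ : X₂ ≤ C * D ^ 3)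
    (hprob : ∀ q, 0 < q → C * q ^ 2 ≤ 2 * N * q ^ 3 + q * X₁ + X₂) : False := by
  have hD1 : 2 ^ 26 * (t + 1) ^ 2 ≤ D :=
    (Nat.mul_le_mul_left _ (Nat.pow_le_pow_right (by omega) (by norm_num))).trans hD
  have hDt : 2 ^ 17 * t ^ 2 ≤ D :=
    (Nat.mul_le_mul (by norm_num) (Nat.pow_le_pow_left (by omega) 2)).trans hD1
  have hDt' : 2 ^ 12 * t ≤ D := by nlinarith
  have hD0 : 0 < D := by omega
  have hS : N * D ^ 2 ≤ 4 * S₂ := by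
    refine le_of_mul_le_mul_left (a := N) ?_ hN
    have := Nat.pow_le_pow_left hlow 2
    linarith
  have hS₁ : 16 * S₁ ≤ N * D ^ 2 := by
    have : 16 * (N * D) ≤ D * (N * D) := Nat.mul_le_mul_right _ (by omega)
    linarith
  have hM16 : 16 * M ≤ N * D ^ 2 := by
    refine le_trans (Nat.mul_le_mul_right _ ?_) hM
    have : 0 < t ^ 2 := by positivity
    omega
  have hND : N * D ^ 2 ≤ 8 * t * C := by linarith
  have hCpos : 0 < C := by
    rcases Nat.eq_zero_or_pos C with rfl | h
    · have : 0 < N * D ^ 2 := by positivity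
      omega
    · exact h
  obtain ⟨q, hq1, hq2⟩ : ∃ q, 64 * t * q ≤ D ^ 2 ∧ D ^ 2 < 64 * t * (q + 1) := by
    refine ⟨D ^ 2 / (64 * t), Nat.mul_div_le _ _, ?_⟩
    exact Nat.lt_mul_div_succ _ (by omega)
  have hq0 : 0 < q := by
    rcases Nat.eq_zero_or_pos q with rfl | h
    · have := Nat.le_self_pow (n := 2) (by norm_num) D
      rw [zero_add, mul_one] at hq2
      omega
    · exact h
  have hDq : D ^ 2 ≤ 128 * t * q := by
    have := Nat.mul_le_mul_left (64 * t) hq0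
    linarith
  have i1 : 8 * N * q ≤ C := by
    refine le_of_mul_le_mul_left (a := 64 * t) ?_ (by omega)
    have := Nat.mul_le_mul_left (8 * N) hq1
    linarith
  have i2 : 8 * D ^ 2 * M ≤ C * q := by
    have h1 : 2 ^ 10 * t * M ≤ C := by
      refine le_of_mul_le_mul_left (a := 8 * t) ?_ (by omega)
      linarith
    have h2 := Nat.mul_le_mul_right q h1
    have h3 := Nat.mul_le_mul_right (8 * M) hDq
    linarith
  have i3 : 24 * D + 8 ≤ q := by
    refine le_of_mul_le_mul_left (a := 128 * t) ?_ (by omega)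
    have : D * (2 ^ 12 * t) ≤ D * D := Nat.mul_le_mul_left _ hDt'
    have : 128 * t * 8 ≤ 128 * t * (8 * D) := Nat.mul_le_mul_left _ (by omega)
    linarith
  have i4 : 8 * D ^ 3 ≤ q ^ 2 := by
    refine le_of_mul_le_mul_left (a := 2 ^ 14 * t ^ 2) ?_ (by positivity)
    have h1 := Nat.pow_le_pow_left hDq 2
    have h2 := Nat.mul_le_mul_right (D ^ 3) hDt
    linarith
  have hp := hprob q hq0
  have j1 := Nat.mul_le_mul_right (q ^ 2) i1
  have j2 := Nat.mul_le_mul_right q i2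
  have j3 := Nat.mul_le_mul_right (C * q) i3
  have j4 := Nat.mul_le_mul_left C i4
  have j5 := Nat.mul_le_mul_left q hX₁
  have hpos : 0 < C * q ^ 2 := by positivity
  linarith

theorem EvenHoleFree.lt_of_dense_backNbrs {n : ℕ} {G : SimpleGraph (Fin n)} [DecidableRel G.Adj]
    (hG : EvenHoleFree G) {ord : Fin n → ℕ} (hord : Function.Injective ord) {U : Finset (Fin n)}
    (hU : U.Nonempty) {D : ℕ} (hD : ∀ v ∈ U, (backNbrs G ord U v).card ≤ D)
    (hlow : D * U.card ≤ 2 * ∑ v ∈ U, (backNbrs G ord U v).card) :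
    D < 2 ^ 26 * (omegaNum G + 1) ^ 6 := by
  by_contra hcon
  push Not at hcon
  set t := omegaNum G with ht
  have ht0 : 0 < t := by
    obtain ⟨v, -⟩ := hU
    have := card_le_omegaNum G {v} (by simp +contextual)
    rw [Finset.card_singleton] at this
    omega
  have hE : ∀ v ∈ U, 2 ^ 13 * t ^ 2 * backEdges G ord U v ≤ D ^ 2 := by
    intro v hv
    have h1 := hG.sq_sum_degree_le (backNbrs G ord U v)
    have h2 := Nat.pow_le_pow_left (hD v hv) 3
    change backEdges G ord U v ^ 2 ≤ _ at h1
    rw [← ht] at h1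
    rw [← Nat.pow_le_pow_iff_left (n := 2) (by norm_num)]
    have h3 : t * (t + 1) ≤ (t + 1) ^ 2 := by nlinarith
    have h4 : t ^ 4 ≤ (t + 1) ^ 4 := Nat.pow_le_pow_left (by omega) 4
    calc (2 ^ 13 * t ^ 2 * backEdges G ord U v) ^ 2
        = 2 ^ 26 * t ^ 4 * backEdges G ord U v ^ 2 := by ring
      _ ≤ 2 ^ 26 * (t + 1) ^ 4 * ((t + 1) ^ 2 * D ^ 3) :=
          Nat.mul_le_mul (Nat.mul_le_mul_left _ h4) (h1.trans (Nat.mul_le_mul h3 h2))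
      _ = 2 ^ 26 * (t + 1) ^ 6 * D ^ 3 := by ring
      _ ≤ D * D ^ 3 := Nat.mul_le_mul_right _ hcon
      _ = (D ^ 2) ^ 2 := by ring
  refine false_of_dense_counts (N := U.card) (C := (minCherries G ord U).card) ht0
    (Finset.card_pos.2 hU) hcon (sum_sq_card_backNbrs_le G ord U) sq_sum_le_card_mul_sum_sq hlow
    ?_ ?_ (hG.card_cherries_le ord U) (sum_card_forbiddenVerts_le hD)
    (sum_card_forbiddenPairs_le hD) ?_
  · exact Finset.sum_le_card_nsmul _ _ _ hD
  · rw [Finset.mul_sum]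
    exact Finset.sum_le_card_nsmul _ _ _ hE
  · intro q hq
    have hmem : ∀ z ∈ minCherries G ord U, z.1 ∈ U ∧ z.2.1 ∈ backNbrs G ord U z.1 ∧
        z.2.2 ∈ backNbrs G ord U z.1 ∧ z.2.1 ≠ z.2.2 ∧ ¬ G.Adj z.2.1 z.2.2 :=
      fun z hz => mem_cherries.1 (mem_minCherries.1 hz).1
    refine card_mul_sq_le_of_sparse_selection U (minCherries G ord U) (fun z => z.2.1)
      (fun z => z.2.2) (forbiddenVerts G ord U) (forbiddenPairs G ord U)
      (fun z hz => (hmem z hz).2.2.2.1)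
      (fun z hz => ⟨(mem_backNbrs.1 (hmem z hz).2.1).1, (mem_backNbrs.1 (hmem z hz).2.2.1).1⟩)
      ?_ ?_ ?_ q hq
    · intro z _ x hx
      have := (Finset.mem_sdiff.1 hx).2
      simpa using this
    · intro z _ x hx
      exact (Finset.mem_filter.1 hx).2
    · intro A₀ hA₀ S hS hgood
      exact hG.card_good_cherries_le hord hA₀ hS hgood

theorem exists_order_of_degenerate {n : ℕ} {G : SimpleGraph (Fin n)} [DecidableRel G.Adj] {d : ℕ}
    (hd : ∀ U : Finset (Fin n), U.Nonempty → ∃ v ∈ U, (U.filter fun u => G.Adj v u).card ≤ d) :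
    ∃ ord : Fin n → ℕ, Function.Injective ord ∧
      ∀ v, (backNbrs G ord Finset.univ v).card ≤ d := by
  have key : ∀ (k : ℕ) (U : Finset (Fin n)), U.card = k → ∃ ord : Fin n → ℕ,
      Set.InjOn ord U ∧ (∀ v ∈ U, ord v < k) ∧ ∀ v ∈ U, (backNbrs G ord U v).card ≤ d := by
    intro k
    induction k with
    | zero =>
      intro U hU
      rw [Finset.card_eq_zero] at hU
      subst hU
      exact ⟨fun _ => 0, by simp, by simp, by simp⟩
    | succ k ih =>
      intro U hU
      obtain ⟨v, hv, hvd⟩ := hd U (Finset.card_pos.1 (by omega))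
      obtain ⟨ord, h1, h2, h3⟩ := ih (U.erase v) (by rw [Finset.card_erase_of_mem hv]; omega)
      have hne : ∀ u ∈ U, u ≠ v → Function.update ord v k u = ord u ∧ ord u < k := by
        intro u hu huv
        exact ⟨Function.update_of_ne huv _ _, h2 u (Finset.mem_erase.2 ⟨huv, hu⟩)⟩
      have hvv : Function.update ord v k v = k := Function.update_self _ _ _
      refine ⟨Function.update ord v k, ?_, ?_, ?_⟩
      · intro x hx y hy hxy
        by_cases hxv : x = v <;> by_cases hyv : y = v
        · exact hxv.trans hyv.symm
        · have := hne y hy hyv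
          rw [hxv, hvv, this.1] at hxy
          omega
        · have := hne x hx hxv
          rw [hyv, hvv, this.1] at hxy
          omega
        · rw [(hne x hx hxv).1, (hne y hy hyv).1] at hxy
          exact h1 (Finset.mem_erase.2 ⟨hxv, hx⟩) (Finset.mem_erase.2 ⟨hyv, hy⟩) hxy
      · intro u hu
        by_cases huv : u = v
        · rw [huv, hvv]; omega
        · have := hne u hu huv
          omega
      · intro u hu
        by_cases huv : u = v
        · subst huv
          refine le_trans (Finset.card_le_card ?_) hvd
          intro x hx
          have := mem_backNbrs.1 hx
          exact Finset.mem_filter.2 ⟨this.1, this.2.1⟩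
        · refine le_trans (Finset.card_le_card ?_) (h3 u (Finset.mem_erase.2 ⟨huv, hu⟩))
          intro x hx
          have hx' := mem_backNbrs.1 hx
          have hu' := hne u hu huv
          have hxv : x ≠ v := by
            rintro rfl
            rw [hvv, hu'.1] at hx'
            omega
          rw [(hne x hx'.1 hxv).1, hu'.1] at hx'
          exact mem_backNbrs.2 ⟨Finset.mem_erase.2 ⟨hxv, hx'.1⟩, hx'.2⟩
  obtain ⟨ord, h1, -, h3⟩ := key _ Finset.univ rfl
  exact ⟨ord, by simpa [Set.injOn_univ] using h1, fun v => h3 v (Finset.mem_univ v)⟩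

theorem two_mul_sum_card_backNbrs {V : Type*} [DecidableEq V] (G : SimpleGraph V)
    [DecidableRel G.Adj] {ord : V → ℕ} (hord : Function.Injective ord) (U : Finset V) :
    2 * ∑ v ∈ U, (backNbrs G ord U v).card = ∑ v ∈ U, (U.filter fun u => G.Adj v u).card := by
  have h1 : ∀ v ∈ U, (U.filter fun u => G.Adj v u).card = (backNbrs G ord U v).card +
      (U.filter fun u => G.Adj u v ∧ ord v < ord u).card := by
    intro v _
    rw [backNbrs, ← Finset.card_union_of_disjoint]
    · congr 1
      ext u
      simp only [Finset.mem_filter, Finset.mem_union]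
      constructor
      · rintro ⟨hu, hvu⟩
        rcases lt_trichotomy (ord u) (ord v) with h | h | h
        · exact Or.inl ⟨hu, hvu, h⟩
        · exact absurd (hord h) hvu.ne.symm
        · exact Or.inr ⟨hu, hvu.symm, h⟩
      · rintro (h | h)
        · exact ⟨h.1, h.2.1⟩
        · exact ⟨h.1, h.2.1.symm⟩
    · rw [Finset.disjoint_filter]
      intro u _ h h'
      exact lt_asymm h.2 h'.2
  have h2 : ∑ v ∈ U, (U.filter fun u => G.Adj u v ∧ ord v < ord u).card =
      ∑ v ∈ U, (backNbrs G ord U v).card := by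
    simp only [backNbrs, Finset.card_filter]
    exact Finset.sum_comm
  rw [Finset.sum_congr rfl h1, Finset.sum_add_distrib, h2, two_mul]

theorem EvenHoleFree.exists_order {n : ℕ} {G : SimpleGraph (Fin n)} [DecidableRel G.Adj]
    (hG : EvenHoleFree G) : ∃ ord : Fin n → ℕ, Function.Injective ord ∧
      ∀ v, (backNbrs G ord Finset.univ v).card ≤ 2 ^ 26 * (omegaNum G + 1) ^ 6 := by
  classical
  let P : ℕ → Prop := fun d => ∀ U : Finset (Fin n), U.Nonempty →
    ∃ v ∈ U, (U.filter fun u => G.Adj v u).card ≤ d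
  have hP : ∃ d, P d := by
    refine ⟨n, fun U ⟨v, hv⟩ => ⟨v, hv, ?_⟩⟩
    simpa using Finset.card_le_univ (U.filter fun u => G.Adj v u)
  obtain ⟨ord, h1, h2⟩ := exists_order_of_degenerate (Nat.find_spec hP)
  refine ⟨ord, h1, fun v => (h2 v).trans ?_⟩
  rcases Nat.eq_zero_or_pos (Nat.find hP) with h0 | h0
  · rw [h0]; exact Nat.zero_le _
  have hnot := Nat.find_min hP (Nat.sub_one_lt h0.ne')
  simp only [P] at hnot
  push Not at hnot
  obtain ⟨U, hU, hdeg⟩ := hnot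
  refine (hG.lt_of_dense_backNbrs h1 hU (D := Nat.find hP) ?_ ?_).le
  · intro v _
    exact (Finset.card_le_card (Finset.filter_subset_filter _ (Finset.subset_univ U))).trans (h2 v)
  · rw [two_mul_sum_card_backNbrs G h1, mul_comm, ← smul_eq_mul]
    refine Finset.card_nsmul_le_sum _ _ _ fun v hv => ?_
    have := hdeg v hv
    omega

/-- `c 0, …, c (g - 1)` enumerates cyclically an induced cycle of length `g` whose last vertex in
the order is `c 0`. -/
structure IsHoleLabeling {V : Type*} (G : SimpleGraph V) (ord : V → ℕ) (g : ℕ) (c : ℕ → V) :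
    Prop where
  ne : ∀ i j, i < j → j < g → c i ≠ c j
  adj_iff : ∀ i j, i < j → j < g → (G.Adj (c i) (c j) ↔ j = i + 1 ∨ (i = 0 ∧ j + 1 = g))
  lt : ∀ i, 0 < i → i < g → ord (c i) < ord (c 0)

theorem IsHoleLabeling.eq_of_eq {V : Type*} {G : SimpleGraph V} {ord : V → ℕ} {g : ℕ} {c : ℕ → V}
    (hc : IsHoleLabeling G ord g c) {i j : ℕ} (hi : i < g) (hj : j < g) (h : c i = c j) :
    i = j := by
  rcases lt_trichotomy i j with h' | h' | h'
  · exact absurd h (hc.ne i j h' hj)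
  · exact h'
  · exact absurd h.symm (hc.ne j i h' hi)

theorem exists_isHoleLabeling {n g : ℕ} {G : SimpleGraph (Fin n)} {ord : Fin n → ℕ}
    (hord : Function.Injective ord) (hg : 3 < g) {S : Set (Fin n)}
    (hS : Nonempty (G.induce S ≃g cycleGraph g)) :
    ∃ c : ℕ → Fin n, IsHoleLabeling G ord g c ∧ S = {v | ∃ i < g, c i = v} := by
  obtain ⟨e⟩ := hS
  obtain ⟨m, rfl⟩ : ∃ m, g = m + 1 := ⟨g - 1, by omega⟩
  obtain ⟨r, -, hr⟩ := Finset.univ.exists_max_image (fun i : Fin (m + 1) => ord (e.symm i))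
    Finset.univ_nonempty
  let c : ℕ → Fin n := fun i => e.symm (r + Fin.ofNat (m + 1) i)
  have hcast : ∀ i (hi : i < m + 1), Fin.ofNat (m + 1) i = ⟨i, hi⟩ := fun i hi =>
    Fin.ext (Nat.mod_eq_of_lt hi)
  have hne : ∀ i j, i < j → j < m + 1 → c i ≠ c j := by
    intro i j hij hj h
    have h1 := add_left_cancel (e.symm.injective (Subtype.ext h))
    rw [hcast i (by omega), hcast j hj, Fin.mk.injEq] at h1
    omega
  refine ⟨c, ⟨hne, ?_, ?_⟩, ?_⟩
  · intro i j hij hj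
    have h1 : G.Adj (c i) (c j) ↔ (cycleGraph (m + 1)).Adj (r + Fin.ofNat (m + 1) i)
        (r + Fin.ofNat (m + 1) j) :=
      e.symm.map_adj_iff (v := r + Fin.ofNat (m + 1) i) (w := r + Fin.ofNat (m + 1) j)
    rw [h1, cycleGraph_adj', add_sub_add_left_eq_sub, add_sub_add_left_eq_sub,
      hcast i (by omega), hcast j hj, Fin.coe_sub_iff_lt.2 (by simpa using hij),
      Fin.coe_sub_iff_le.2 (by simpa using hij.le)]
    simp only
    omega
  · intro i hi hi'
    have h1 := hr (r + Fin.ofNat (m + 1) i) (Finset.mem_univ _)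
    have h2 : c 0 = e.symm r := by simp [c]
    refine lt_of_le_of_ne (h2 ▸ h1) fun h => hne 0 i hi hi' (hord h).symm
  · ext v
    constructor
    · intro hv
      refine ⟨(e ⟨v, hv⟩ - r : Fin (m + 1)), (e ⟨v, hv⟩ - r : Fin (m + 1)).2, ?_⟩
      simp only [c]
      rw [hcast _ (e ⟨v, hv⟩ - r : Fin (m + 1)).2]
      simp
    · rintro ⟨i, -, rfl⟩
      exact (e.symm _).2

/-- The colour of the `i`-th vertex of a labelled hole. -/
def holeColour (i : ℕ) : Fin 4 :=
  if i = 0 then 0 else if i % 2 = 1 then 1 else 2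

/-- The colouring `χ` follows the pattern of the labelled hole `c` on the hole and on its
back-neighbours. -/
structure IsGoodColouring {n : ℕ} (G : SimpleGraph (Fin n)) [DecidableRel G.Adj]
    (ord : Fin n → ℕ) (g : ℕ) (c : ℕ → Fin n) (χ : Fin n → Fin 4) : Prop where
  colour : ∀ i < g, χ (c i) = holeColour i
  colour_back : ∀ i < g, ∀ u ∈ backNbrs G ord Finset.univ (c i), (∀ j < g, u ≠ c j) → χ u = 3

theorem exists_path_of_seq {V : Type*} {Γ : SimpleGraph V} (c : ℕ → V) (a k : ℕ)
    (hadj : ∀ i, a ≤ i → i < a + k → Γ.Adj (c i) (c (i + 1)))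
    (hne : ∀ i j, a ≤ i → i < j → j ≤ a + k → c i ≠ c j) :
    ∃ p : Γ.Walk (c a) (c (a + k)), p.IsPath ∧
      ∀ x, x ∈ p.support ↔ ∃ i, a ≤ i ∧ i ≤ a + k ∧ c i = x := by
  induction k with
  | zero =>
    refine ⟨Walk.nil, Walk.IsPath.nil, fun x => ?_⟩
    simp only [Walk.support_nil, List.mem_singleton]
    constructor
    · rintro rfl; exact ⟨a, le_rfl, le_rfl, rfl⟩
    · rintro ⟨i, h1, h2, rfl⟩
      rw [show i = a by omega]
  | succ k ih =>
    obtain ⟨p, hp, hs⟩ := ih (fun i h1 h2 => hadj i h1 (by omega))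
      (fun i j h1 h2 h3 => hne i j h1 h2 (by omega))
    refine ⟨p.concat (hadj (a + k) (by omega) (by omega)), hp.concat ?_ _, fun x => ?_⟩
    · rw [hs]
      rintro ⟨i, h1, h2, h3⟩
      exact hne i (a + k + 1) h1 (by omega) le_rfl h3
    · rw [Walk.support_concat, List.mem_append, hs, List.mem_singleton]
      constructor
      · rintro (⟨i, h1, h2, h3⟩ | rfl)
        · exact ⟨i, h1, by omega, h3⟩
        · exact ⟨a + k + 1, by omega, le_rfl, rfl⟩
      · rintro ⟨i, h1, h2, h3⟩
        rcases Nat.lt_or_ge i (a + k + 1) with h | h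
        · exact Or.inl ⟨i, h1, by omega, h3⟩
        · have : i = a + k + 1 := by omega
          exact Or.inr (this ▸ h3.symm)

theorem holeColour_ne_three (i : ℕ) : holeColour i ≠ 3 := by
  unfold holeColour
  split_ifs <;> decide

theorem holeColour_odd {i : ℕ} (h : i % 2 = 1) : holeColour i = 1 := by
  rw [holeColour, if_neg (by omega), if_pos h]

theorem holeColour_even {i : ℕ} (h : i % 2 = 0) (h0 : 0 < i) : holeColour i = 2 := by
  rw [holeColour, if_neg (by omega), if_neg (by omega)]

theorem holeColour_ne_of_adj {V : Type*} {G : SimpleGraph V} {ord : V → ℕ} {g : ℕ} {c : ℕ → V}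
    (hodd : Odd g) (hg : 3 < g) (hc : IsHoleLabeling G ord g c) {i j : ℕ} (hi : i < g) (hj : j < g)
    (h : G.Adj (c i) (c j)) : holeColour i ≠ holeColour j := by
  wlog hij : i < j generalizing i j
  · have hne : i ≠ j := by
      rintro rfl
      exact G.loopless.irrefl _ h
    exact (this hj hi h.symm (by omega)).symm
  obtain ⟨m, rfl⟩ := hodd
  have h1 := (hc.adj_iff i j hij hj).1 h
  unfold holeColour
  split_ifs <;> first | decide | omega

theorem IsGoodColouring.eq_of_mem_backNbrs {n : ℕ} {G : SimpleGraph (Fin n)} [DecidableRel G.Adj]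
    {ord : Fin n → ℕ} {g : ℕ} {c : ℕ → Fin n} {χ : Fin n → Fin 4} (hodd : Odd g) (hg : 3 < g)
    (hc : IsHoleLabeling G ord g c) (hχ : IsGoodColouring G ord g c χ) {u : Fin n}
    (hu : u ∈ backNbrs G ord Finset.univ (c 0)) :
    (χ u = 1 → u = c 1) ∧ (χ u = 2 → u = c (g - 1)) := by
  obtain ⟨m, rfl⟩ := hodd
  by_cases h : ∀ j < 2 * m + 1, u ≠ c j
  · rw [hχ.colour_back 0 (by omega) u hu h]
    exact ⟨fun h => absurd h (by decide), fun h => absurd h (by decide)⟩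
  push Not at h
  obtain ⟨j, hj, rfl⟩ := h
  have hadj := (mem_backNbrs.1 hu).2.1
  have hj0 : j ≠ 0 := by
    rintro rfl
    exact G.loopless.irrefl _ hadj
  rw [hχ.colour j hj]
  rcases (hc.adj_iff 0 j (by omega) hj).1 hadj with h | ⟨-, h⟩
  · rw [h]
    exact ⟨fun _ => rfl, fun h => absurd h (by decide)⟩
  · rw [holeColour_even (by omega) (by omega), show 2 * m + 1 - 1 = j by omega]
    exact ⟨fun h => absurd h (by decide), fun _ => rfl⟩

/-- The vertices of colour `k` without a back-neighbour of colour `k`. -/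
def colourRoots {n : ℕ} (G : SimpleGraph (Fin n)) [DecidableRel G.Adj] (ord : Fin n → ℕ)
    (χ : Fin n → Fin 4) (k : Fin 4) : Set (Fin n) :=
  {v | χ v = k ∧ ∀ u ∈ backNbrs G ord Finset.univ v, χ u ≠ k}

theorem not_adj_of_mem_colourRoots {n : ℕ} {G : SimpleGraph (Fin n)} [DecidableRel G.Adj]
    {ord : Fin n → ℕ} (hord : Function.Injective ord) {χ : Fin n → Fin 4} {k : Fin 4}
    (x : Fin n) (hx : x ∈ colourRoots G ord χ k) (y : Fin n) (hy : y ∈ colourRoots G ord χ k) :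
    ¬ G.Adj x y := by
  intro h
  rcases lt_trichotomy (ord x) (ord y) with h' | h' | h'
  · exact hy.2 x (mem_backNbrs.2 ⟨Finset.mem_univ _, h.symm, h'⟩) hx.1
  · exact G.loopless.irrefl _ (hord h' ▸ h)
  · exact hx.2 y (mem_backNbrs.2 ⟨Finset.mem_univ _, h, h'⟩) hy.1

theorem IsGoodColouring.mem_colourRoots {n : ℕ} {G : SimpleGraph (Fin n)} [DecidableRel G.Adj]
    {ord : Fin n → ℕ} {g : ℕ} {c : ℕ → Fin n} {χ : Fin n → Fin 4} (hodd : Odd g) (hg : 3 < g)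
    (hc : IsHoleLabeling G ord g c) (hχ : IsGoodColouring G ord g c χ) {i : ℕ} (hi : i < g) :
    c i ∈ colourRoots G ord χ (holeColour i) := by
  refine ⟨hχ.colour i hi, fun u hu => ?_⟩
  by_cases h : ∀ j < g, u ≠ c j
  · rw [hχ.colour_back i hi u hu h]
    exact (holeColour_ne_three i).symm
  push Not at h
  obtain ⟨j, hj, rfl⟩ := h
  rw [hχ.colour j hj]
  exact (holeColour_ne_of_adj hodd hg hc hi hj (mem_backNbrs.1 hu).2.1).symm

theorem IsGoodColouring.exists_path {n : ℕ} {G : SimpleGraph (Fin n)} [DecidableRel G.Adj]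
    {ord : Fin n → ℕ} {g : ℕ} {c : ℕ → Fin n} {χ : Fin n → Fin 4} (hodd : Odd g) (hg : 3 < g)
    (hc : IsHoleLabeling G ord g c) (hχ : IsGoodColouring G ord g c χ) :
    ∃ p : (bipartiteBetween G (colourRoots G ord χ 1) (colourRoots G ord χ 2)).Walk
      (c 1) (c (g - 1)), p.IsPath ∧ ∀ x, x ∈ p.support ↔ ∃ i, 1 ≤ i ∧ i < g ∧ c i = x := by
  obtain ⟨p, hp, hs⟩ := exists_path_of_seq
    (Γ := bipartiteBetween G (colourRoots G ord χ 1) (colourRoots G ord χ 2)) c 1 (g - 2)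
    (fun i h1 h2 => by
      refine ⟨(hc.adj_iff i (i + 1) (by omega) (by omega)).2 (Or.inl rfl), ?_⟩
      have hi := hχ.mem_colourRoots hodd hg hc (i := i) (by omega)
      have hi' := hχ.mem_colourRoots hodd hg hc (i := i + 1) (by omega)
      rcases Nat.mod_two_eq_zero_or_one i with h | h
      · rw [holeColour_even h (by omega)] at hi
        rw [holeColour_odd (by omega)] at hi'
        exact Or.inr ⟨hi, hi'⟩
      · rw [holeColour_odd h] at hi
        rw [holeColour_even (by omega) (by omega)] at hi'
        exact Or.inl ⟨hi, hi'⟩)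
    (fun i j _ h2 h3 => hc.ne i j h2 (by omega))
  have he : c (1 + (g - 2)) = c (g - 1) := congrArg c (by omega)
  refine ⟨p.copy rfl he, by simpa using hp, fun x => ?_⟩
  rw [Walk.support_copy, hs]
  exact exists_congr fun i => and_congr_right fun _ => and_congr_left fun _ => by omega

theorem IsGoodColouring.hole_eq {n : ℕ} {G : SimpleGraph (Fin n)} [DecidableRel G.Adj]
    (hG : EvenHoleFree G) {ord : Fin n → ℕ} (hord : Function.Injective ord) {g : ℕ}
    {c c' : ℕ → Fin n} {χ : Fin n → Fin 4} (hodd : Odd g) (hg : 3 < g)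
    (hc : IsHoleLabeling G ord g c) (hχ : IsGoodColouring G ord g c χ)
    (hc' : IsHoleLabeling G ord g c') (hχ' : IsGoodColouring G ord g c' χ) (h0 : c 0 = c' 0) :
    {v | ∃ i < g, c i = v} = {v | ∃ i < g, c' i = v} := by
  have hback : ∀ i, (i = 1 ∨ i = g - 1) → c' i ∈ backNbrs G ord Finset.univ (c 0) := by
    intro i hi
    rw [mem_backNbrs, h0, hc'.adj_iff 0 i (by omega) (by omega)]
    exact ⟨Finset.mem_univ _, by omega, hc'.lt i (by omega) (by omega)⟩
  have hpar : (g - 1) % 2 = 0 := by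
    obtain ⟨m, rfl⟩ := hodd
    omega
  have h1 : c' 1 = c 1 := (hχ.eq_of_mem_backNbrs hodd hg hc (hback 1 (Or.inl rfl))).1
    ((hχ'.colour 1 (by omega)).trans (holeColour_odd rfl))
  have h2 : c' (g - 1) = c (g - 1) :=
    (hχ.eq_of_mem_backNbrs hodd hg hc (hback (g - 1) (Or.inr rfl))).2
      ((hχ'.colour (g - 1) (by omega)).trans (holeColour_even hpar (by omega)))
  have hdis : Disjoint (colourRoots G ord χ 1) (colourRoots G ord χ 2) :=
    Set.disjoint_left.2 fun x hx hx' => absurd (hx.1.symm.trans hx'.1) (by decide)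
  have hac := hG.isAcyclic_bipartiteBetween hdis (not_adj_of_mem_colourRoots hord)
    (not_adj_of_mem_colourRoots hord)
  obtain ⟨p, hp, hs⟩ := hχ.exists_path hodd hg hc
  obtain ⟨p', hp', hs'⟩ := hχ'.exists_path hodd hg hc'
  have hpp : p'.copy h1 h2 = p := congrArg Subtype.val ((hac.subsingleton_path _ _).elim
    (⟨p'.copy h1 h2, by simpa using hp'⟩ : (bipartiteBetween G _ _).Path _ _) ⟨p, hp⟩)
  have hsupp : ∀ x, x ∈ p.support ↔ x ∈ p'.support := fun x => by rw [← hpp, Walk.support_copy]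
  have hsplit : ∀ (d : ℕ → Fin n) (v : Fin n),
      (∃ i < g, d i = v) ↔ d 0 = v ∨ ∃ i, 1 ≤ i ∧ i < g ∧ d i = v := by
    intro d v
    constructor
    · rintro ⟨i, hi, h⟩
      rcases Nat.eq_zero_or_pos i with rfl | h'
      · exact Or.inl h
      · exact Or.inr ⟨i, h', hi, h⟩
    · rintro (h | ⟨i, -, hi, h⟩)
      · exact ⟨0, by omega, h⟩
      · exact ⟨i, hi, h⟩
  ext v
  rw [Set.mem_ofPred_eq, Set.mem_ofPred_eq, hsplit c, hsplit c', ← hs, ← hs', hsupp, h0]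

theorem IsHoleLabeling.pow_card_le {n : ℕ} {G : SimpleGraph (Fin n)} [DecidableRel G.Adj]
    {ord : Fin n → ℕ} {D g : ℕ} (hD : ∀ v, (backNbrs G ord Finset.univ v).card ≤ D)
    {c : ℕ → Fin n} (hc : IsHoleLabeling G ord g c)
    [DecidablePred fun χ : Fin n → Fin 4 => IsGoodColouring G ord g c χ] :
    4 ^ n ≤ (Finset.univ.filter fun χ : Fin n → Fin 4 => IsGoodColouring G ord g c χ).card *
      4 ^ (g * (D + 1)) := by
  classical
  let Y : Finset (Fin n) := (Finset.range g).biUnion fun i =>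
    insert (c i) (backNbrs G ord Finset.univ (c i))
  let τ : Fin n → Fin 4 := fun v => if h : ∃ i < g, c i = v then holeColour h.choose else 3
  have hY : Y.card ≤ g * (D + 1) := by
    refine (Finset.card_biUnion_le_card_mul _ _ (D + 1) fun i _ => ?_).trans
      (by rw [Finset.card_range])
    exact (Finset.card_insert_le _ _).trans (Nat.succ_le_succ (hD _))
  have hgood : ∀ χ : Fin n → Fin 4, (∀ y ∈ Y, χ y = τ y) → IsGoodColouring G ord g c χ := by
    intro χ hχ
    refine ⟨fun i hi => ?_, fun i hi u hu hne => ?_⟩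
    · rw [hχ (c i) (Finset.mem_biUnion.2
        ⟨i, Finset.mem_range.2 hi, Finset.mem_insert_self _ _⟩)]
      have h : ∃ j < g, c j = c i := ⟨i, hi, rfl⟩
      simp only [τ, dif_pos h]
      rw [hc.eq_of_eq h.choose_spec.1 hi h.choose_spec.2]
    · rw [hχ u (Finset.mem_biUnion.2
        ⟨i, Finset.mem_range.2 hi, Finset.mem_insert_of_mem hu⟩)]
      have h : ¬ ∃ j < g, c j = u := fun ⟨j, hj, h⟩ => hne j hj h.symm
      simp only [τ, dif_neg h]
  have hcyl := card_cylinder_mul_pow Y τ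
  rw [Fintype.card_fin, Fintype.card_fin] at hcyl
  refine hcyl.symm.le.trans (Nat.mul_le_mul (Finset.card_le_card fun χ hχ => ?_) (Nat.pow_le_pow_right (by norm_num) hY))
  exact Finset.mem_filter.2 ⟨Finset.mem_univ _, hgood χ (by simpa using hχ)⟩

theorem EvenHoleFree.holeCount_le {n : ℕ} {G : SimpleGraph (Fin n)} [DecidableRel G.Adj]
    (hG : EvenHoleFree G) {ord : Fin n → ℕ} (hord : Function.Injective ord) {D g : ℕ}
    (hodd : Odd g) (hg : 3 < g) (hD : ∀ v, (backNbrs G ord Finset.univ v).card ≤ D) :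
    holeCount g G ≤ 4 ^ (g * (D + 1)) * n := by
  classical
  let Q : Finset (Set (Fin n)) :=
    Finset.univ.filter fun S => Nonempty (G.induce S ≃g cycleGraph g)
  have hQ : holeCount g G = Q.card := by
    rw [holeCount, ← Set.ncard_coe_finset]
    simp [Q]
  obtain rfl | hn := Nat.eq_zero_or_pos n
  · rw [hQ, Finset.card_eq_zero.2, mul_zero]
    refine Finset.filter_eq_empty_iff.2 fun S _ hS => ?_
    obtain ⟨c, -⟩ := exists_isHoleLabeling hord hg hS
    exact (c 0).elim0
  have hex : ∀ S : Set (Fin n), ∃ c : ℕ → Fin n, S ∈ Q →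
      IsHoleLabeling G ord g c ∧ S = {v | ∃ i < g, c i = v} := by
    intro S
    by_cases hS : S ∈ Q
    · obtain ⟨c, hc⟩ := exists_isHoleLabeling hord hg (Finset.mem_filter.1 hS).2
      exact ⟨c, fun _ => hc⟩
    · exact ⟨fun _ => ⟨0, hn⟩, fun h => absurd h hS⟩
  choose c hc using hex
  have hrow : ∀ S ∈ Q, 4 ^ n ≤
      (Finset.univ.filter fun χ : Fin n → Fin 4 => IsGoodColouring G ord g (c S) χ).card *
        4 ^ (g * (D + 1)) := fun S hS => (hc S hS).1.pow_card_le hD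
  have hcol : ∀ χ : Fin n → Fin 4,
      (Q.filter fun S => IsGoodColouring G ord g (c S) χ).card ≤ n := by
    intro χ
    have h := Finset.card_le_card_of_injOn (s := Q.filter fun S => IsGoodColouring G ord g (c S) χ)
      (t := Finset.univ) (fun S => c S 0) (fun _ _ => Finset.mem_univ _) (by
        intro S hS S' hS' h
        rw [Finset.mem_coe, Finset.mem_filter] at hS hS'
        rw [(hc S hS.1).2, (hc S' hS'.1).2]
        exact IsGoodColouring.hole_eq hG hord hodd hg (hc S hS.1).1 hS.2 (hc S' hS'.1).1 hS'.2 h)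
    rwa [Finset.card_univ, Fintype.card_fin] at h
  have hdouble := Finset.sum_card_bipartiteAbove_eq_sum_card_bipartiteBelow
    (s := Q) (t := (Finset.univ : Finset (Fin n → Fin 4)))
    (fun S χ => IsGoodColouring G ord g (c S) χ)
  simp only [Finset.bipartiteAbove, Finset.bipartiteBelow] at hdouble
  rw [hQ]
  refine Nat.le_of_mul_le_mul_right (c := 4 ^ n) ?_ (by positivity)
  calc Q.card * 4 ^ n = ∑ S ∈ Q, 4 ^ n := by rw [Finset.sum_const, smul_eq_mul]
    _ ≤ ∑ S ∈ Q, (Finset.univ.filter fun χ : Fin n → Fin 4 =>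
          IsGoodColouring G ord g (c S) χ).card * 4 ^ (g * (D + 1)) := Finset.sum_le_sum hrow
    _ = (∑ χ : Fin n → Fin 4, (Q.filter fun S => IsGoodColouring G ord g (c S) χ).card) *
          4 ^ (g * (D + 1)) := by rw [← Finset.sum_mul, hdouble]
    _ ≤ (∑ _χ : Fin n → Fin 4, n) * 4 ^ (g * (D + 1)) :=
        Nat.mul_le_mul_right _ (Finset.sum_le_sum fun χ _ => hcol χ)
    _ = 4 ^ (g * (D + 1)) * n * 4 ^ n := by
        rw [Finset.sum_const, Finset.card_univ, Fintype.card_fun, Fintype.card_fin,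
          Fintype.card_fin, smul_eq_mul]
        ring

/-- There is a function `φ` such that every even hole-free graph `G` has at
most `φ(g, ω(G))·|V(G)|` holes of length `g`, for every odd `g > 3`. -/
theorem holes_linear_evenHoleFree :
    ∃ φ : ℕ → ℕ → ℕ, ∀ g : ℕ, Odd g → 3 < g →
      ∀ (n : ℕ) (G : SimpleGraph (Fin n)), EvenHoleFree G →
        holeCount g G ≤ φ g (omegaNum G) * n := by
  classical
  refine ⟨fun g t => 4 ^ (g * (2 ^ 26 * (t + 1) ^ 6 + 1)), fun g hodd hg n G hG => ?_⟩
  obtain ⟨ord, hord, hD⟩ := hG.exists_order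
  exact hG.holeCount_le hord hodd hg hD
end
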